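/- Let Mⁿ ⊂ ℝ^{n+1} be a closed, smooth, strictly convex hypersurface with support function h and Gauss curvature 𝒦 (viewed as functions on 𝕊ⁿ). Then ∫_{𝕊ⁿ} (Δ̄h)/𝒦 dμ ≥ 0, where Δ̄ is the Laplace–Beltrami operator of the round sphere and μ the spherical Lebesgue measure. -/

import Mathlib

/-!
We work with the unit sphere `𝕊ⁿ = sphere 0 1 ⊆ ℝ^{n+1}`.  A `C²` function `u` on `𝕊ⁿ` is
represented by its positively 1-homogeneous extension `u : ℝ^{n+1} → ℝ` (which is `C²` away
from the origin).  For such an extension, the ambient Euclidean Hessian `D²u(x)` at a point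
`x ∈ 𝕊ⁿ` annihilates the radial direction `x` and its restriction to the tangent space
`x^⊥ = T_x𝕊ⁿ` coincides with the spherical bilinear form `∇̄²u + ḡ u`.  Consequently:

* the eigenvalues of `∇̄²u + ḡ u` w.r.t. `ḡ` are the eigenvalues of the ambient Hessian
  matrix other than the trivial zero radial one, so for `0 ≤ k ≤ n` the elementary symmetric
  function `σ_k(∇̄²u + ḡ u, ḡ)` equals the `k`-th elementary symmetric function of all the
  eigenvalues of the ambient Hessian matrix, which is `(-1)^k` times the coefficient of
  `t^{n+1-k}` in its characteristic polynomial (`sigmaElem` below);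
* the spherical gradient `Du(x)` is the tangential part `∇u(x) - u(x)x` of the ambient
  gradient (`sphGrad` below);
* `u` is convex (resp. the hypersurface with support function `u` is strictly convex) iff the
  Hessian form is positive semidefinite (resp. positive definite on `x^⊥`) at every `x ∈ 𝕊ⁿ`.

The spherical Lebesgue measure `μ` is the `n`-dimensional Hausdorff measure `μH[n]`.
-/

open MeasureTheory Metric
open scoped RealInnerProductSpace

noncomputable section

/-- The ambient Euclidean space `ℝ^{n+1}`. -/
abbrev Esp (n : ℕ) := EuclideanSpace ℝ (Fin (n + 1))

/-- The ambient Hessian bilinear form `D²u(x)(v,w)` of `u : ℝ^{n+1} → ℝ`. -/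
def hessForm (n : ℕ) (u : Esp n → ℝ) (x v w : Esp n) : ℝ :=
  fderiv ℝ (fun y => fderiv ℝ u y w) x v

/-- The ambient Hessian matrix of `u` at `x` in the standard orthonormal coordinates. -/
def hessMatrix (n : ℕ) (u : Esp n → ℝ) (x : Esp n) : Matrix (Fin (n + 1)) (Fin (n + 1)) ℝ :=
  Matrix.of fun i j => hessForm n u x (EuclideanSpace.single i 1) (EuclideanSpace.single j 1)

/-- For a positively 1-homogeneous `u` and `x ∈ 𝕊ⁿ`, `k ≤ n`, this is
`σ_k(∇̄²u + ḡ u, ḡ)(x)`, the `k`-th elementary symmetric function of the eigenvalues of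
`∇̄²u + ḡ u` w.r.t. `ḡ`, computed from the characteristic polynomial of the ambient Hessian. -/
def sigmaElem (n k : ℕ) (u : Esp n → ℝ) (x : Esp n) : ℝ :=
  (-1 : ℝ) ^ k * ((hessMatrix n u x).charpoly.coeff (n + 1 - k))

/-- The spherical gradient `Du(x)` at `x ∈ 𝕊ⁿ`: the tangential part of the ambient gradient. -/
def sphGrad (n : ℕ) (u : Esp n → ℝ) (x : Esp n) : Esp n :=
  gradient u x - u x • x

/-- `u` is positively 1-homogeneous (i.e. it is the canonical extension of `u|_{𝕊ⁿ}`). -/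
def PosHom (n : ℕ) (u : Esp n → ℝ) : Prop :=
  ∀ r : ℝ, 0 < r → ∀ x : Esp n, u (r • x) = r * u x

/-- The spherical Lebesgue measure on `ℝ^{n+1}` (to be restricted to `𝕊ⁿ`):
the `n`-dimensional Hausdorff measure. -/
def sphMeasure (n : ℕ) : Measure (Esp n) := μH[(n : ℝ)]

section

/-- Comparison of uniformly distributed measures on a compact metric space, finite case. -/
theorem unif_nonneg_finite {X : Type*} [MetricSpace X] [CompactSpace X] [MeasurableSpace X]
    [BorelSpace X] (μ ν : Measure X) [IsFiniteMeasure μ] [IsFiniteMeasure ν]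
    (hμ : ∀ r : ℝ, ∀ x y : X, μ (ball x r) = μ (ball y r))
    (hν : ∀ r : ℝ, ∀ x y : X, ν (ball x r) = ν (ball y r))
    (hpos : ∀ r : ℝ, 0 < r → ∀ x, ν (ball x r) ≠ 0)
    (f : X → ℝ) (hf : Continuous f) (hfν : 0 ≤ ∫ x, f x ∂ν) : 0 ≤ ∫ x, f x ∂μ := by
  rcases isEmpty_or_nonempty X with hX | ⟨⟨x₀⟩⟩
  · rw [integral_of_isEmpty]
  have hmeasset : ∀ δ : ℝ, MeasurableSet {p : X × X | dist p.1 p.2 < δ} := fun δ =>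
    (isOpen_lt continuous_dist continuous_const).measurableSet
  have hfi : ∀ m : Measure X, IsFiniteMeasure m → Integrable f m := fun m _ =>
    hf.integrable_of_hasCompactSupport (HasCompactSupport.of_compactSpace f)
  -- Fubini identity
  have key : ∀ g : X → ℝ, Continuous g → ∀ δ : ℝ,
      ν.real (ball x₀ δ) * ∫ x, g x ∂μ = ∫ y, (∫ x in ball y δ, g x ∂μ) ∂ν := by
    intro g hg δ
    have hgi : Integrable (fun p : X × X => g p.1) (μ.prod ν) :=
      (hg.comp continuous_fst).integrable_of_hasCompactSupport (HasCompactSupport.of_compactSpace _)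
    have hfint : Integrable ({p : X × X | dist p.1 p.2 < δ}.indicator (fun p => g p.1)) (μ.prod ν) :=
      hgi.indicator (hmeasset δ)
    have h1 := integral_integral_swap (f := fun x y =>
      {p : X × X | dist p.1 p.2 < δ}.indicator (fun p => g p.1) (x, y)) (μ := μ) (ν := ν) hfint
    have h2 : ∀ x, ∫ y, {p : X × X | dist p.1 p.2 < δ}.indicator (fun p => g p.1) (x, y) ∂ν
        = ν.real (ball x₀ δ) * g x := by
      intro x
      have : (fun y => {p : X × X | dist p.1 p.2 < δ}.indicator (fun p => g p.1) (x, y))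
          = (ball x δ).indicator (fun _ => g x) := by
        ext y
        simp only [Set.indicator, Set.mem_ofPred_eq, mem_ball, dist_comm]
      rw [this, integral_indicator measurableSet_ball, setIntegral_const, smul_eq_mul,
        Measure.real, hν δ x x₀]; rfl
    have h3 : ∀ y, ∫ x, {p : X × X | dist p.1 p.2 < δ}.indicator (fun p => g p.1) (x, y) ∂μ
        = ∫ x in ball y δ, g x ∂μ := by
      intro y
      rw [← integral_indicator measurableSet_ball]
      congr 1
    simp only [h2, h3] at h1
    rw [integral_const_mul] at h1
    exact h1
  have hB : ∀ δ y, μ.real (ball y δ) = μ.real (ball x₀ δ) := fun δ y => by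
    rw [Measure.real, hμ δ y x₀]; rfl
  refine le_of_forall_pos_le_add ?_
  intro ε' hε'
  set ε := ε' / (μ.real Set.univ + 1) with hε
  have hεpos : 0 < ε := by positivity
  obtain ⟨δ, hδ, hδf⟩ := Metric.uniformContinuous_iff.1
    (CompactSpace.uniformContinuous_of_continuous hf) ε hεpos
  have hνpos : 0 < ν.real (ball x₀ δ) := by
    rw [measureReal_def]; exact ENNReal.toReal_pos (hpos δ hδ x₀) (measure_ne_top _ _)
  have e1 := key f hf δ
  have e2 := key (fun _ => 1) continuous_const δ
  simp only [integral_const, smul_eq_mul, mul_one, measureReal_restrict_apply_univ, hB] at e2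
  have e3 : ∫ y, (f y - ε) * μ.real (ball x₀ δ) ∂ν ≤ ∫ y, (∫ x in ball y δ, f x ∂μ) ∂ν := by
    refine integral_mono ?_ ?_ ?_
    · exact ((hfi ν inferInstance).sub (integrable_const _)).mul_const _
    · have hgi : Integrable (fun p : X × X => f p.1) (μ.prod ν) :=
        (hf.comp continuous_fst).integrable_of_hasCompactSupport
          (HasCompactSupport.of_compactSpace _)
      have hfint := (hgi.indicator (hmeasset δ)).integral_prod_right
      refine hfint.congr (Filter.Eventually.of_forall fun y => ?_)
      dsimp only
      rw [← integral_indicator measurableSet_ball]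
      congr 1
    · intro y
      dsimp only
      have : ∫ x in ball y δ, (f y - ε) ∂μ ≤ ∫ x in ball y δ, f x ∂μ := by
        refine setIntegral_mono_on (integrable_const _) (hfi μ inferInstance).integrableOn
          measurableSet_ball ?_
        intro x hx
        have := hδf (mem_ball.1 hx)
        rw [Real.dist_eq] at this
        linarith [(abs_lt.1 this).1]
      rw [setIntegral_const, smul_eq_mul, hB] at this
      linarith
  rw [integral_mul_const, integral_sub (hfi ν inferInstance) (integrable_const _)] at e3
  simp only [integral_const, smul_eq_mul] at e3
  have hμB : 0 ≤ μ.real (ball x₀ δ) := measureReal_nonneg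
  have e4 : -(ε * μ.real Set.univ) * ν.real (ball x₀ δ) ≤ (∫ x, f x ∂μ) * ν.real (ball x₀ δ) := by
    have := mul_nonneg hfν hμB
    nlinarith
  have e5 := le_of_mul_le_mul_right e4 hνpos
  have e6 : ε * μ.real Set.univ ≤ ε' := by
    rw [hε, div_mul_eq_mul_div, div_le_iff₀ (by positivity)]
    nlinarith [measureReal_nonneg (μ := μ) (s := Set.univ)]
  linarith

/-- Comparison of uniformly distributed measures, general case. -/
theorem unif_nonneg {X : Type*} [MetricSpace X] [CompactSpace X] [MeasurableSpace X]
    [BorelSpace X] (μ ν : Measure X) [IsFiniteMeasure ν]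
    (hμ : ∀ r : ℝ, ∀ x y : X, μ (ball x r) = μ (ball y r))
    (hν : ∀ r : ℝ, ∀ x y : X, ν (ball x r) = ν (ball y r))
    (hpos : ∀ r : ℝ, 0 < r → ∀ x, ν (ball x r) ≠ 0)
    (f : X → ℝ) (hf : Continuous f) (hfν : 0 ≤ ∫ x, f x ∂ν) : 0 ≤ ∫ x, f x ∂μ := by
  by_cases hfin : μ Set.univ = ⊤
  · -- infinite measure: every ball has infinite measure
    have hball : ∀ r : ℝ, 0 < r → ∀ x, μ (ball x r) = ⊤ := by
      intro r hr x
      by_contra hne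
      obtain ⟨t, -, htf, ht⟩ := (isCompact_univ (X := X)).finite_cover_balls hr
      have : μ Set.univ < ⊤ := by
        refine (measure_mono ht).trans_lt ?_
        refine (measure_biUnion_lt_top htf ?_)
        intro y _
        rw [hμ r y x]
        exact lt_top_iff_ne_top.2 hne
      exact this.ne hfin
    by_cases hfint : Integrable f μ
    · have h0 : ∀ x, f x = 0 := by
        intro x
        by_contra hx
        have hx' : 0 < |f x| / 2 := by positivity
        have hopen : IsOpen {y | |f x| / 2 < ‖f y‖} := isOpen_lt continuous_const hf.norm
        have hmem : x ∈ {y | |f x| / 2 < ‖f y‖} := by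
          simp only [Set.mem_ofPred_eq, Real.norm_eq_abs]; linarith
        obtain ⟨r, hr, hsub⟩ := Metric.isOpen_iff.1 hopen x hmem
        have h1 := hfint.measure_norm_ge_lt_top hx'
        have h2 : μ (ball x r) ≤ μ {a | |f x| / 2 ≤ ‖f a‖} :=
          measure_mono fun y hy => by
            have h3 : |f x| / 2 < ‖f y‖ := hsub hy
            exact h3.le
        rw [hball r hr x] at h2
        exact absurd h1 (not_lt.2 h2)
      simp [h0]
    · rw [integral_undef hfint]
  · have : IsFiniteMeasure μ := ⟨lt_top_iff_ne_top.2 hfin⟩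
    exact unif_nonneg_finite μ ν hμ hν hpos f hf hfν

/-- Uniformity of the spherical Hausdorff measure. -/
theorem sphMeasure_unif (n : ℕ) (r : ℝ) (x y : sphere (0 : Esp n) 1) :
    ((sphMeasure n).comap (Subtype.val : sphere (0 : Esp n) 1 → Esp n)) (ball x r) =
    ((sphMeasure n).comap (Subtype.val : sphere (0 : Esp n) 1 → Esp n)) (ball y r) := by
  have hemb := MeasurableEmbedding.subtype_coe (isClosed_sphere (x := (0 : Esp n)) (ε := 1)).measurableSet
  rw [hemb.comap_apply, hemb.comap_apply]
  have hxy : ‖(x : Esp n)‖ = ‖(y : Esp n)‖ := by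
    rw [norm_eq_of_mem_sphere x, norm_eq_of_mem_sphere y]
  set R := (ℝ ∙ ((x : Esp n) - y))ᗮ.reflection with hR
  have hRx : R x = y := Submodule.reflection_sub hxy
  have himg : R.toIsometryEquiv '' (Subtype.val '' (ball x r)) = Subtype.val '' (ball y r) := by
    ext z
    constructor
    · rintro ⟨_, ⟨w, hw, rfl⟩, rfl⟩
      refine ⟨⟨R w, by simp⟩, ?_, rfl⟩
      rw [mem_ball, Subtype.dist_eq] at hw ⊢
      simp only
      rw [← hRx, R.dist_map]; exact hw
    · rintro ⟨w, hw, rfl⟩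
      refine ⟨R.symm w, ⟨⟨R.symm w, by simp⟩, ?_, rfl⟩, by simp⟩
      rw [mem_ball, Subtype.dist_eq] at hw ⊢
      simp only
      rw [← R.dist_map, hRx]; simpa using hw
  rw [← himg]
  simp only [sphMeasure, IsometryEquiv.hausdorffMeasure_image]

open scoped Pointwise in
/-- Uniformity of the measure `toSphere`. -/
theorem toSphere_unif (n : ℕ) (r : ℝ) (x y : sphere (0 : Esp n) 1) :
    (volume : Measure (Esp n)).toSphere (ball x r) =
    (volume : Measure (Esp n)).toSphere (ball y r) := by
  rw [Measure.toSphere_apply' _ measurableSet_ball, Measure.toSphere_apply' _ measurableSet_ball]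
  have hxy : ‖(x : Esp n)‖ = ‖(y : Esp n)‖ := by
    rw [norm_eq_of_mem_sphere x, norm_eq_of_mem_sphere y]
  set R := (ℝ ∙ ((x : Esp n) - y))ᗮ.reflection with hR
  have hRx : R x = y := Submodule.reflection_sub hxy
  have himg : R '' (Set.Ioo (0 : ℝ) 1 • (Subtype.val '' (ball x r)))
      = Set.Ioo (0 : ℝ) 1 • (Subtype.val '' (ball y r)) := by
    ext z
    constructor
    · rintro ⟨_, ⟨t, ht, _, ⟨w, hw, rfl⟩, rfl⟩, rfl⟩
      refine ⟨t, ht, R w, ⟨⟨R w, by simp⟩, ?_, rfl⟩, by simp⟩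
      rw [mem_ball, Subtype.dist_eq] at hw ⊢
      simp only
      rw [← hRx, R.dist_map]; exact hw
    · rintro ⟨t, ht, _, ⟨w, hw, rfl⟩, rfl⟩
      refine ⟨t • R.symm w, ⟨t, ht, R.symm w, ⟨⟨R.symm w, by simp⟩, ?_, rfl⟩, rfl⟩, by simp⟩
      rw [mem_ball, Subtype.dist_eq] at hw ⊢
      simp only
      rw [← R.dist_map, hRx]; simpa using hw
  rw [← himg]
  congr 1
  rw [← R.coe_toMeasurableEquiv, MeasurableEquiv.image_eq_preimage_symm]
  exact (MeasurePreserving.measure_preimage_equiv (f := R.toMeasurableEquiv.symm) R.symm.measurePreserving _).symm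

/-- Reduction to the measure `toSphere`. -/
theorem sph_nonneg_of_toSphere (n : ℕ) (f : Esp n → ℝ)
    (hf : Continuous (fun x : sphere (0 : Esp n) 1 => f x))
    (h0 : 0 ≤ ∫ x : sphere (0 : Esp n) 1, f x ∂((volume : Measure (Esp n)).toSphere)) :
    0 ≤ ∫ x in sphere (0 : Esp n) 1, f x ∂(sphMeasure n) := by
  rw [← integral_subtype_comap (isClosed_sphere).measurableSet]
  refine unif_nonneg _ (volume : Measure (Esp n)).toSphere (sphMeasure_unif n) (toSphere_unif n)
    ?_ _ hf h0
  intro r hr x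
  exact (isOpen_ball.measure_pos _ ⟨x, mem_ball_self hr⟩).ne'

end

section

open Matrix in
/-- Determinant of a rank one perturbation along the kernel. -/
theorem det_add_rankOne (n : ℕ) (M : Matrix (Fin (n + 1)) (Fin (n + 1)) ℝ) (x g : Fin (n + 1) → ℝ)
    (hsymm : Mᵀ = M) (hMx : M *ᵥ x = 0) (hx : x ⬝ᵥ x = 1) :
    (M + vecMulVec g x).det = (g ⬝ᵥ x) * ((-1) ^ n * M.charpoly.coeff 1) := by
  have hxM : x ᵥ* M = 0 := by rw [← hsymm, vecMul_transpose, hMx]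
  set N := M + vecMulVec x x with hN
  have hxN : x ᵥ* N = x := by
    rw [hN, vecMul_add, hxM, zero_add, vecMul_vecMulVec, hx, one_smul]
  -- first factorization
  have h1 : M + vecMulVec g x = (1 + vecMulVec (g - x) x) * N := by
    rw [add_mul, one_mul, vecMulVec_mul, hxN, hN, sub_vecMulVec]
    abel
  have h2 : (1 + vecMulVec (g - x) x).det = g ⬝ᵥ x := by
    rw [vecMulVec_eq Unit, det_one_add_replicateCol_mul_replicateRow, dotProduct_sub, hx,
      dotProduct_comm]
    ring
  have hdetM : M.det = 0 := by
    refine exists_mulVec_eq_zero_iff.1 ⟨x, ?_, hMx⟩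
    rintro rfl
    simp at hx
  -- second factorization, at polynomial level via evaluation
  have h3 : N.det = (-1) ^ n * M.charpoly.coeff 1 := by
    have hpoly : Polynomial.X * N.charpoly = (Polynomial.X - 1) * M.charpoly := by
      refine Polynomial.eq_of_infinite_eval_eq _ _ ?_
      refine Set.Infinite.mono (s := Set.Ioi (0 : ℝ)) ?_ (Set.Ioi_infinite _)
      intro t ht
      have ht' : t ≠ 0 := ne_of_gt ht
      change _ = _
      simp only [Polynomial.eval_mul, Polynomial.eval_X, Polynomial.eval_sub, Polynomial.eval_one,
        eval_charpoly]
      have hs : ∀ A : Matrix (Fin (n + 1)) (Fin (n + 1)) ℝ,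
          scalar (Fin (n + 1)) t - A = t • 1 - A := by
        intro A
        rw [scalar_apply, smul_one_eq_diagonal]
      rw [hs, hs]
      have h4 : t • 1 - N = (1 + vecMulVec (-(t⁻¹ • x)) x) * (t • 1 - M) := by
        rw [add_mul, one_mul, vecMulVec_mul, vecMul_sub, hxM, sub_zero, vecMul_smul, vecMul_one, hN,
          vecMulVec_smul, neg_vecMulVec, smul_vecMulVec, smul_neg, smul_smul, mul_inv_cancel₀ ht',
          one_smul]
        abel
      have h5 : (1 + vecMulVec (-(t⁻¹ • x)) x).det = 1 - t⁻¹ := by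
        rw [vecMulVec_eq Unit, det_one_add_replicateCol_mul_replicateRow, dotProduct_neg,
          dotProduct_smul, hx]
        simp [sub_eq_add_neg]
      rw [h4, det_mul, h5, ← mul_assoc]
      congr 1
      field_simp
    have hc := congrArg (fun p => Polynomial.coeff p 1) hpoly
    simp only [sub_mul, one_mul, Polynomial.coeff_sub] at hc
    have hX : ∀ p : Polynomial ℝ, (Polynomial.X * p).coeff 1 = p.coeff 0 := fun p =>
      Polynomial.coeff_X_mul p 0
    rw [hX, hX] at hc
    have hd := det_eq_sign_charpoly_coeff N
    have hd' := det_eq_sign_charpoly_coeff M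
    rw [hdetM] at hd'
    simp only [Fintype.card_fin] at hd hd'
    have hz : M.charpoly.coeff 0 = 0 := by
      have : ((-1 : ℝ) ^ (n + 1)) ≠ 0 := by positivity
      rcases mul_eq_zero.1 hd'.symm with h | h
      · exact absurd h this
      · exact h
    rw [hd, hc, hz]
    simp [pow_succ]
  rw [h1, det_mul, h2, h3]

open Matrix in
/-- Spectral data of the ambient Hessian. -/
theorem spectral_data (n : ℕ) (M : Matrix (Fin (n + 1)) (Fin (n + 1)) ℝ) (x : Fin (n + 1) → ℝ)
    (hsymm : Mᵀ = M) (hMx : M *ᵥ x = 0) (hx : x ⬝ᵥ x = 1)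
    (hpos : ∀ v : Fin (n + 1) → ℝ, v ⬝ᵥ x = 0 → v ≠ 0 → 0 < v ⬝ᵥ M *ᵥ v) :
    ∃ (s : Finset (Fin (n + 1))) (l : Fin (n + 1) → ℝ), s.card = n ∧ (∀ j ∈ s, 0 < l j) ∧
      M.trace = ∑ j ∈ s, l j ∧ (-1) ^ n * M.charpoly.coeff 1 = ∏ j ∈ s, l j ∧
      (∀ t : ℝ, (t • (1 : Matrix (Fin (n + 1)) (Fin (n + 1)) ℝ) - M).det = t * ∏ j ∈ s, (t - l j)) ∧
      (∀ t : ℝ, (∀ v : Fin (n + 1) → ℝ, v ⬝ᵥ x = 0 → t * (v ⬝ᵥ v) ≤ v ⬝ᵥ M *ᵥ v) →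
        ∀ j ∈ s, t ≤ l j) := by
  have hH : M.IsHermitian := by
    rw [IsHermitian, conjTranspose_eq_transpose_of_trivial, hsymm]
  set l := hH.eigenvalues with hl
  have hxM : x ᵥ* M = 0 := by rw [← hsymm, vecMul_transpose, hMx]
  have hdetM : M.det = 0 := by
    refine exists_mulVec_eq_zero_iff.1 ⟨x, ?_, hMx⟩
    rintro rfl
    simp at hx
  obtain ⟨i₀, hi₀⟩ : ∃ i, l i = 0 := by
    have := hH.det_eq_prod_eigenvalues
    rw [hdetM] at this
    obtain ⟨i, -, hi⟩ := Finset.prod_eq_zero_iff.1 this.symm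
    exact ⟨i, by simpa using hi⟩
  -- eigenvectors as plain functions
  set b : Fin (n + 1) → Fin (n + 1) → ℝ := fun i => (hH.eigenvectorBasis i).ofLp with hb
  have hMb : ∀ i, M *ᵥ b i = l i • b i := fun i => hH.mulVec_eigenvectorBasis i
  have horth : ∀ i j, b i ⬝ᵥ b j = if i = j then 1 else 0 := by
    intro i j
    have := (orthonormal_iff_ite.1 hH.eigenvectorBasis.orthonormal) i j
    rw [← this, EuclideanSpace.inner_eq_star_dotProduct]
    simp [hb, dotProduct_comm]
  -- the kernel eigenvector is parallel to `x`
  have hker : b i₀ = (b i₀ ⬝ᵥ x) • x := by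
    by_contra hne
    set w := b i₀ - (b i₀ ⬝ᵥ x) • x with hw
    have hw0 : w ≠ 0 := sub_ne_zero.2 hne
    have hwx : w ⬝ᵥ x = 0 := by rw [hw, sub_dotProduct, smul_dotProduct, hx]; simp
    have := hpos w hwx hw0
    have hMw : M *ᵥ w = 0 := by
      rw [hw, mulVec_sub, hMb, hi₀, mulVec_smul, hMx]; simp
    rw [hMw] at this
    simp at this
  have hperp : ∀ j, j ≠ i₀ → b j ⬝ᵥ x = 0 := by
    intro j hj
    have h1 := horth j i₀
    rw [if_neg hj, hker, dotProduct_smul, smul_eq_mul] at h1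
    rcases mul_eq_zero.1 h1 with h2 | h2
    · have h3 := horth i₀ i₀
      rw [hker, h2] at h3
      simp at h3
    · exact h2
  have hlb : ∀ j, b j ⬝ᵥ M *ᵥ b j = l j := by
    intro j
    rw [hMb, dotProduct_smul, horth]; simp
  refine ⟨Finset.univ.erase i₀, l, by simp, ?_, ?_, ?_, ?_, ?_⟩
  · intro j hj
    have hj' := Finset.ne_of_mem_erase hj
    rw [← hlb j]
    refine hpos _ (hperp j hj') ?_
    intro h0
    have := horth j j
    rw [h0] at this
    simp at this
  · rw [hH.trace_eq_sum_eigenvalues, ← Finset.add_sum_erase _ _ (Finset.mem_univ i₀)]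
    change ((l i₀ : ℝ) : ℝ) + _ = _
    rw [hi₀]; simp [hl]
  · rw [hH.charpoly_eq, ← Finset.mul_prod_erase _ _ (Finset.mem_univ i₀)]
    change _ * ((Polynomial.X - Polynomial.C (l i₀)) * _ : Polynomial ℝ).coeff (0 + 1) = _
    rw [hi₀, Polynomial.C_0, sub_zero, Polynomial.coeff_X_mul, Polynomial.coeff_zero_eq_eval_zero,
      Polynomial.eval_prod]
    simp only [Polynomial.eval_sub, Polynomial.eval_X, Polynomial.eval_C, zero_sub]
    rw [Finset.prod_neg]
    simp only [Finset.card_erase_of_mem (Finset.mem_univ i₀), Finset.card_univ, Fintype.card_fin,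
      Nat.add_sub_cancel]
    rw [← mul_assoc, ← mul_pow]
    simp [hl]
  · intro t
    have h1 : (t • (1 : Matrix (Fin (n + 1)) (Fin (n + 1)) ℝ) - M).det = M.charpoly.eval t := by
      rw [eval_charpoly, scalar_apply, smul_one_eq_diagonal]
    rw [h1, hH.charpoly_eq, Polynomial.eval_prod,
      ← Finset.mul_prod_erase _ _ (Finset.mem_univ i₀)]
    simp only [Polynomial.eval_sub, Polynomial.eval_X, Polynomial.eval_C]
    change (t - l i₀) * _ = _
    rw [hi₀, sub_zero]
    rfl
  · intro t ht j hj
    have h1 := ht (b j) (hperp j (Finset.ne_of_mem_erase hj))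
    rw [hlb, horth] at h1
    simpa using h1

/-- The algebraic inequality behind Heintze–Karcher. -/
theorem prod_sub_le (n : ℕ) (hn : 1 ≤ n) {ι : Type*} (s : Finset ι) (l : ι → ℝ) (hs : s.card = n)
    (t : ℝ) (ht : 0 < t) (hl : ∀ j ∈ s, t ≤ l j) :
    t ≤ (∑ j ∈ s, l j) / n ∧
    ∏ j ∈ s, (l j - t) ≤ (∏ j ∈ s, l j) * (1 - t / ((∑ j ∈ s, l j) / n)) ^ n := by
  have hn' : (0 : ℝ) < n := by exact_mod_cast hn
  have hsum : (n : ℝ) * t ≤ ∑ j ∈ s, l j := by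
    have := Finset.card_nsmul_le_sum s l t hl
    rwa [hs, nsmul_eq_mul] at this
  have hsumpos : 0 < ∑ j ∈ s, l j := lt_of_lt_of_le (by positivity) hsum
  refine ⟨by rw [le_div_iff₀ hn']; linarith, ?_⟩
  have hlpos : ∀ j ∈ s, 0 < l j := fun j hj => ht.trans_le (hl j hj)
  have h1 : ∏ j ∈ s, (l j - t) = (∏ j ∈ s, l j) * ∏ j ∈ s, (1 - t / l j) := by
    rw [← Finset.prod_mul_distrib]
    refine Finset.prod_congr rfl fun j hj => ?_
    have := (hlpos j hj).ne'
    field_simp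
  rw [h1]
  have hnn : ∀ j ∈ s, 0 ≤ 1 - t / l j := fun j hj => by
    rw [sub_nonneg, div_le_one (hlpos j hj)]; exact hl j hj
  refine mul_le_mul_of_nonneg_left ?_ (Finset.prod_nonneg fun j hj => (hlpos j hj).le)
  -- AM-GM
  have h2 : ∏ j ∈ s, (1 - t / l j) ≤ ((∑ j ∈ s, (1 - t / l j)) / n) ^ n := by
    have h3 := Real.geom_mean_le_arith_mean s (fun _ => (1 : ℝ)) (fun j => 1 - t / l j)
      (fun _ _ => zero_le_one) (by simp [hs]; omega) hnn
    simp only [Real.rpow_one, one_mul, Finset.sum_const, hs, nsmul_eq_mul, mul_one] at h3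
    have h4 := pow_le_pow_left₀ (Real.rpow_nonneg (Finset.prod_nonneg hnn) _) h3 n
    rwa [Real.rpow_inv_natCast_pow (Finset.prod_nonneg hnn) (by omega)] at h4
  refine h2.trans (pow_le_pow_left₀ (div_nonneg (Finset.sum_nonneg hnn) hn'.le) ?_ n)
  -- AM-HM
  have h4 : (n : ℝ) ^ 2 ≤ (∑ j ∈ s, l j) * ∑ j ∈ s, (l j)⁻¹ := by
    have h5 := Finset.sum_sq_le_sum_mul_sum_of_sq_le_mul s (r := fun _ => (1 : ℝ)) (f := l)
      (g := fun j => (l j)⁻¹) (fun j hj => (hlpos j hj).le) (fun j hj => (inv_pos.2 (hlpos j hj)).le)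
      (fun j hj => by rw [mul_inv_cancel₀ (hlpos j hj).ne']; norm_num)
    simpa [hs] using h5
  have h6 : ∑ j ∈ s, (1 - t / l j) = n - t * ∑ j ∈ s, (l j)⁻¹ := by
    rw [Finset.sum_sub_distrib, Finset.mul_sum]
    simp [hs, div_eq_mul_inv]
  rw [h6, sub_div, div_self hn'.ne']
  have h7 : t / ((∑ j ∈ s, l j) / n) ≤ t * (∑ j ∈ s, (l j)⁻¹) / n := by
    rw [div_div_eq_mul_div, div_le_div_iff₀ hsumpos hn']
    nlinarith
  linarith

end

section

/-- Smooth support functions. -/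
structure GoodSupp (n : ℕ) (h : Esp n → ℝ) : Prop where
  sm : ContDiffOn ℝ (⊤ : ℕ∞) h {(0 : Esp n)}ᶜ
  hom : PosHom n h
  conv : ∀ x ∈ sphere (0 : Esp n) 1, ∀ v : Esp n,
      ⟪v, x⟫ = 0 → v ≠ 0 → 0 < hessForm n h x v v

/-- Second derivative. -/
def D2 (n : ℕ) (h : Esp n → ℝ) (y : Esp n) : Esp n →L[ℝ] Esp n →L[ℝ] ℝ :=
  fderiv ℝ (fderiv ℝ h) y

/-- The identification of covectors with vectors. -/
def covec (n : ℕ) : (Esp n →L[ℝ] ℝ) →L[ℝ] Esp n :=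
  ∑ i : Fin (n + 1), (ContinuousLinearMap.apply ℝ ℝ (EuclideanSpace.single i (1 : ℝ) : Esp n)).smulRight
    (EuclideanSpace.single i (1 : ℝ) : Esp n)

theorem covec_apply (n : ℕ) (φ : Esp n →L[ℝ] ℝ) (i : Fin (n + 1)) :
    (covec n φ) i = φ (EuclideanSpace.single i (1 : ℝ)) := by
  simp [covec, Pi.single_apply]

theorem esp_sum (n : ℕ) (v : Esp n) : v = ∑ i, v i • (EuclideanSpace.single i (1 : ℝ) : Esp n) := by
  ext j
  simp [Pi.single_apply]

theorem inner_covec (n : ℕ) (φ : Esp n →L[ℝ] ℝ) (v : Esp n) : ⟪covec n φ, v⟫ = φ v := by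
  conv_rhs => rw [esp_sum n v]
  simp only [map_sum, map_smul, smul_eq_mul, PiLp.inner_apply, covec_apply]
  refine Finset.sum_congr rfl fun i _ => ?_
  simp

/-- The (0-homogeneous) gradient. -/
def gr (n : ℕ) (h : Esp n → ℝ) (y : Esp n) : Esp n := covec n (fderiv ℝ h y)

theorem inner_gr (n : ℕ) (h : Esp n → ℝ) (y v : Esp n) : ⟪gr n h y, v⟫ = fderiv ℝ h y v :=
  inner_covec n _ v

namespace GoodSupp

variable {n : ℕ} {h : Esp n → ℝ}

theorem contDiffAt (H : GoodSupp n h) {y : Esp n} (hy : y ≠ 0) : ContDiffAt ℝ (⊤ : ℕ∞) h y :=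
  H.sm.contDiffAt (isOpen_compl_singleton.mem_nhds hy)

theorem hasFDerivAt (H : GoodSupp n h) {y : Esp n} (hy : y ≠ 0) :
    HasFDerivAt h (fderiv ℝ h y) y :=
  ((H.contDiffAt hy).differentiableAt (by simp)).hasFDerivAt

theorem contDiffOn_fderiv (H : GoodSupp n h) :
    ContDiffOn ℝ (⊤ : ℕ∞) (fderiv ℝ h) {(0 : Esp n)}ᶜ :=
  H.sm.fderiv_of_isOpen isOpen_compl_singleton (by simp)

theorem hasFDerivAt2 (H : GoodSupp n h) {y : Esp n} (hy : y ≠ 0) :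
    HasFDerivAt (fderiv ℝ h) (D2 n h y) y :=
  ((H.contDiffOn_fderiv.contDiffAt (isOpen_compl_singleton.mem_nhds hy)).differentiableAt
    (by simp)).hasFDerivAt

theorem hasFDerivAt_gr (H : GoodSupp n h) {y : Esp n} (hy : y ≠ 0) :
    HasFDerivAt (gr n h) ((covec n).comp (D2 n h y)) y :=
  (covec n).hasFDerivAt.comp y (H.hasFDerivAt2 hy)

theorem continuousOn_D2 (H : GoodSupp n h) : ContinuousOn (D2 n h) {(0 : Esp n)}ᶜ :=
  (H.contDiffOn_fderiv.fderiv_of_isOpen (m := (⊤ : ℕ∞)) isOpen_compl_singleton (by simp)).continuousOn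

theorem hessForm_eq (H : GoodSupp n h) {y : Esp n} (hy : y ≠ 0) (v w : Esp n) :
    hessForm n h y v w = D2 n h y v w := by
  have h1 : HasFDerivAt (fun z => fderiv ℝ h z w)
      ((ContinuousLinearMap.apply ℝ ℝ w).comp (D2 n h y)) y :=
    (ContinuousLinearMap.apply ℝ ℝ w).hasFDerivAt.comp y (H.hasFDerivAt2 hy)
  rw [hessForm, h1.fderiv]
  rfl

theorem D2_symm (H : GoodSupp n h) {y : Esp n} (hy : y ≠ 0) (v w : Esp n) :
    D2 n h y v w = D2 n h y w v :=
  ((H.contDiffAt hy).isSymmSndFDerivAt (by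
    rw [minSmoothness_of_isRCLikeNormedField]
    exact WithTop.coe_le_coe.2 (le_top : (2 : ℕ∞) ≤ ⊤))) v w

theorem fderiv_smul (H : GoodSupp n h) {r : ℝ} (hr : 0 < r) (y : Esp n) :
    fderiv ℝ h (r • y) = fderiv ℝ h y := by
  rcases eq_or_ne y 0 with rfl | hy
  · simp
  have hry : r • y ≠ 0 := smul_ne_zero hr.ne' hy
  have h1 : HasFDerivAt (fun z : Esp n => h (r • z)) (r • fderiv ℝ h (r • y)) y := by
    have := (H.hasFDerivAt hry).comp y ((hasFDerivAt_id y).const_smul r)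
    have e : fderiv ℝ h (r • y) ∘SL (r • ContinuousLinearMap.id ℝ (Esp n)) = r • fderiv ℝ h (r • y) := by
      ext v; simp
    rw [e] at this
    exact this
  have h2 : HasFDerivAt (fun z : Esp n => h (r • z)) (r • fderiv ℝ h y) y := by
    have := (H.hasFDerivAt hy).const_mul r
    refine this.congr_of_eventuallyEq (Filter.Eventually.of_forall fun z => ?_)
    exact H.hom r hr z
  exact smul_right_injective _ hr.ne' (h1.unique h2)

theorem gr_smul (H : GoodSupp n h) {r : ℝ} (hr : 0 < r) (y : Esp n) :
    gr n h (r • y) = gr n h y := by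
  rw [gr, gr, H.fderiv_smul hr]

theorem D2_smul (H : GoodSupp n h) {r : ℝ} (hr : 0 < r) {y : Esp n} (hy : y ≠ 0) :
    D2 n h (r • y) = r⁻¹ • D2 n h y := by
  have hry : r • y ≠ 0 := smul_ne_zero hr.ne' hy
  have h1 : HasFDerivAt (fun z : Esp n => fderiv ℝ h (r • z)) (r • D2 n h (r • y)) y := by
    have := (H.hasFDerivAt2 hry).comp y ((hasFDerivAt_id y).const_smul r)
    have e : D2 n h (r • y) ∘SL (r • ContinuousLinearMap.id ℝ (Esp n)) = r • D2 n h (r • y) := by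
      ext v; simp
    rw [e] at this
    exact this
  have h2 : HasFDerivAt (fun z : Esp n => fderiv ℝ h (r • z)) (D2 n h y) y := by
    refine (H.hasFDerivAt2 hy).congr_of_eventuallyEq (Filter.Eventually.of_forall fun z => ?_)
    exact H.fderiv_smul hr z
  rw [← h1.unique h2, smul_smul, inv_mul_cancel₀ hr.ne', one_smul]

theorem euler (H : GoodSupp n h) {y : Esp n} (hy : y ≠ 0) : fderiv ℝ h y y = h y := by
  have hl : HasDerivAt (fun s : ℝ => s • y) y 1 := by
    simpa using (hasDerivAt_id (1 : ℝ)).smul_const y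
  have h1 : HasDerivAt (fun s : ℝ => h (s • y)) (fderiv ℝ h y y) 1 := by
    have hf : HasFDerivAt h (fderiv ℝ h y) ((1 : ℝ) • y) := by rw [one_smul]; exact H.hasFDerivAt hy
    exact hf.comp_hasDerivAt (1 : ℝ) hl
  have h2 : HasDerivAt (fun s : ℝ => h (s • y)) (h y) 1 := by
    have : HasDerivAt (fun s : ℝ => s * h y) (h y) 1 := by
      simpa using (hasDerivAt_id (1 : ℝ)).mul_const (h y)
    refine this.congr_of_eventuallyEq ?_
    filter_upwards [lt_mem_nhds (zero_lt_one (α := ℝ))] with s hs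
    exact H.hom s hs y
  exact h1.unique h2

theorem D2_self (H : GoodSupp n h) {y : Esp n} (hy : y ≠ 0) : D2 n h y y = 0 := by
  have hl : HasDerivAt (fun s : ℝ => s • y) y 1 := by
    simpa using (hasDerivAt_id (1 : ℝ)).smul_const y
  have h1 : HasDerivAt (fun s : ℝ => fderiv ℝ h (s • y)) (D2 n h y y) 1 := by
    have hf : HasFDerivAt (fderiv ℝ h) (D2 n h y) ((1 : ℝ) • y) := by
      rw [one_smul]; exact H.hasFDerivAt2 hy
    exact hf.comp_hasDerivAt (1 : ℝ) hl
  have h2 : HasDerivAt (fun s : ℝ => fderiv ℝ h (s • y)) 0 1 := by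
    have : HasDerivAt (fun s : ℝ => fderiv ℝ h y) 0 1 := hasDerivAt_const _ _
    refine this.congr_of_eventuallyEq ?_
    filter_upwards [lt_mem_nhds (zero_lt_one (α := ℝ))] with s hs
    exact H.fderiv_smul hs y
  exact h1.unique h2

theorem D2_self_right (H : GoodSupp n h) {y : Esp n} (hy : y ≠ 0) (v : Esp n) :
    D2 n h y v y = 0 := by
  rw [H.D2_symm hy, H.D2_self hy]; rfl

/-- The unit vector in the direction `y`. -/
theorem exists_unit {y : Esp n} (hy : y ≠ 0) :
    ∃ x ∈ sphere (0 : Esp n) 1, y = ‖y‖ • x := by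
  have hn : ‖y‖ ≠ 0 := norm_ne_zero_iff.2 hy
  refine ⟨‖y‖⁻¹ • y, ?_, ?_⟩
  · simp [norm_smul, hn]
  · rw [smul_smul, mul_inv_cancel₀ hn, one_smul]

theorem ne_zero_of_mem {x : Esp n} (hx : x ∈ sphere (0 : Esp n) 1) : x ≠ 0 := by
  rintro rfl
  simp at hx

theorem D2_pos (H : GoodSupp n h) {y : Esp n} (hy : y ≠ 0) {v : Esp n} (hv : ∀ c : ℝ, v ≠ c • y) :
    0 < D2 n h y v v := by
  obtain ⟨x, hx, hyx⟩ := exists_unit hy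
  have hx0 := ne_zero_of_mem hx
  have hr : 0 < ‖y‖ := norm_pos_iff.2 hy
  have hxx : ⟪x, x⟫ = 1 := by
    rw [real_inner_self_eq_norm_sq]; simp at hx; rw [hx]; norm_num
  rw [hyx, H.D2_smul hr hx0]
  set w := v - ⟪v, x⟫ • x with hw
  have hwx : ⟪w, x⟫ = 0 := by
    rw [hw, inner_sub_left, real_inner_smul_left, hxx]; ring
  have hw0 : w ≠ 0 := by
    intro h0
    refine hv (⟪v, x⟫ * ‖y‖⁻¹) ?_
    rw [mul_smul]
    conv_rhs => rw [hyx]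
    rw [norm_smul, norm_norm, smul_smul (_ * _)⁻¹]
    have hx1 : ‖x‖ = 1 := by simpa using hx
    rw [hx1, mul_one, inv_mul_cancel₀ hr.ne', one_smul]
    exact sub_eq_zero.1 h0
  have h1 := H.conv x hx w hwx hw0
  rw [H.hessForm_eq hx0] at h1
  have h2 : D2 n h x v v = D2 n h x w w := by
    have : v = w + ⟪v, x⟫ • x := by rw [hw]; abel
    rw [this]
    simp [map_add, map_smul, H.D2_self hx0, H.D2_self_right hx0]
  simp only [smul_apply, smul_eq_mul]
  rw [h2]
  positivity

/-- Strict tangent inequality for linearly independent vectors. -/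
theorem lt_of_indep (H : GoodSupp n h) {x z : Esp n} (hx : x ≠ 0) (hz : ∀ c : ℝ, z ≠ c • x) :
    fderiv ℝ h x z < h z := by
  set γ : ℝ → Esp n := fun s => x + s • (z - x) with hγ
  have hγd : ∀ s, HasDerivAt γ (z - x) s := fun s => by
    have h0 := ((hasDerivAt_id s).smul_const (z - x)).const_add x
    rw [one_smul] at h0
    exact h0
  -- linear independence
  have hind : ∀ a b : ℝ, a • x + b • z = 0 → b = 0 := by
    intro a b hab
    by_contra hb
    refine hz (-(b⁻¹ * a)) ?_
    have : b⁻¹ • (a • x + b • z) = 0 := by rw [hab, smul_zero]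
    rw [smul_add, smul_smul, smul_smul, inv_mul_cancel₀ hb, one_smul] at this
    rw [neg_smul]
    exact eq_neg_of_add_eq_zero_right this
  have hγ0 : ∀ s, γ s ≠ 0 := by
    intro s hs
    have h1 : (1 - s) • x + s • z = 0 := by rw [← hs, hγ]; simp only; module
    have h2 := hind _ _ h1
    rw [h2] at h1
    simp at h1
    exact hx h1
  have hγp : ∀ s, ∀ c : ℝ, z - x ≠ c • γ s := by
    intro s c hc
    have h1 : (-1 - c * (1 - s)) • x + (1 - c * s) • z = 0 := by
      have : (-1 - c * (1 - s)) • x + (1 - c * s) • z = (z - x) - c • γ s := by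
        rw [hγ]; simp only; module
      rw [this, hc, sub_self]
    have h2 := hind _ _ h1
    rw [h2, zero_smul, add_zero] at h1
    rcases smul_eq_zero.1 h1 with h3 | h3
    · have : c = 0 - 0 := by linarith
      rw [this] at h2
      norm_num at h2
    · exact hx h3
  have hφ : ∀ s, HasDerivAt (fun s => h (γ s)) (fderiv ℝ h (γ s) (z - x)) s := fun s =>
    (H.hasFDerivAt (hγ0 s)).comp_hasDerivAt s (hγd s)
  have hφ2 : ∀ s, HasDerivAt (fun s => fderiv ℝ h (γ s) (z - x)) (D2 n h (γ s) (z - x) (z - x)) s := by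
    intro s
    have h1 : HasDerivAt (fun s => fderiv ℝ h (γ s)) (D2 n h (γ s) (z - x)) s :=
      (H.hasFDerivAt2 (hγ0 s)).comp_hasDerivAt s (hγd s)
    have h2 := h1.clm_apply (hasDerivAt_const s (z - x))
    simpa using h2
  obtain ⟨c, hc, hce⟩ := exists_hasDerivAt_eq_slope (fun s => h (γ s)) _ zero_lt_one
    (fun s _ => (hφ s).continuousAt.continuousWithinAt) (fun s _ => hφ s)
  obtain ⟨d, hd, hde⟩ := exists_hasDerivAt_eq_slope (fun s => fderiv ℝ h (γ s) (z - x)) _ hc.1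
    (fun s _ => (hφ2 s).continuousAt.continuousWithinAt) (fun s _ => hφ2 s)
  have hpos := H.D2_pos (hγ0 d) (hγp d)
  rw [hde, lt_div_iff₀ (by linarith [hc.1]), zero_mul] at hpos
  have e0 : γ 0 = x := by simp [hγ]
  have e1 : γ 1 = z := by simp [hγ]
  simp only [e0, e1, sub_zero, div_one] at hce hpos
  rw [hce, map_sub, H.euler hx] at hpos
  linarith

/-- For `n ≥ 1` there is a vector not parallel to a given one. -/
theorem exists_indep (hn : 1 ≤ n) {x : Esp n} (hx : x ≠ 0) :
    ∃ w : Esp n, w ≠ 0 ∧ ∀ c : ℝ, x ≠ c • w := by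
  have hfr : Module.finrank ℝ (Esp n) = n + 1 := by simp
  by_contra! hcon
  have hle : Module.finrank ℝ (Esp n) ≤ 1 := by
    refine finrank_le_one x fun w => ?_
    rcases eq_or_ne w 0 with rfl | hw
    · exact ⟨0, by simp⟩
    obtain ⟨c, hc⟩ := hcon w hw
    have hc0 : c ≠ 0 := by
      rintro rfl
      rw [zero_smul] at hc
      exact hx hc
    exact ⟨c⁻¹, by rw [hc, smul_smul, inv_mul_cancel₀ hc0, one_smul]⟩
  omega

theorem add_neg_pos (H : GoodSupp n h) (hn : 1 ≤ n) {x : Esp n} (hx : x ≠ 0) :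
    0 < h x + h (-x) := by
  obtain ⟨w, hw, hwx⟩ := exists_indep hn hx
  have h1 := H.lt_of_indep hw hwx
  have h2 := H.lt_of_indep (z := -x) hw (fun c hc => hwx (-c) (by rw [neg_smul, ← hc, neg_neg]))
  rw [map_neg] at h2
  linarith

/-- Strict support inequality. -/
theorem lt_of_not_pos (H : GoodSupp n h) (hn : 1 ≤ n) {x z : Esp n} (hx : x ≠ 0) (hz0 : z ≠ 0)
    (hz : ∀ c : ℝ, 0 < c → z ≠ c • x) : fderiv ℝ h x z < h z := by
  by_cases hp : ∀ c : ℝ, z ≠ c • x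
  · exact H.lt_of_indep hx hp
  · push Not at hp
    obtain ⟨c, rfl⟩ := hp
    have hc : c < 0 := by
      rcases lt_trichotomy c 0 with h1 | h1 | h1
      · exact h1
      · rw [h1, zero_smul] at hz0; exact absurd rfl hz0
      · exact absurd rfl (hz c h1)
    have h1 : c • x = (-c) • (-x) := by simp
    rw [map_smul, H.euler hx, h1, H.hom (-c) (by linarith), smul_eq_mul]
    nlinarith [H.add_neg_pos hn hx]

theorem le_supp (H : GoodSupp n h) (hn : 1 ≤ n) {x z : Esp n} (hx : x ≠ 0) (hz0 : z ≠ 0) :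
    fderiv ℝ h x z ≤ h z := by
  by_cases hp : ∀ c : ℝ, 0 < c → z ≠ c • x
  · exact (H.lt_of_not_pos hn hx hz0 hp).le
  · push Not at hp
    obtain ⟨c, hc, rfl⟩ := hp
    rw [map_smul, H.euler hx, H.hom c hc, smul_eq_mul]

end GoodSupp

end

section

theorem det_clm_eq (n : ℕ) (f : Esp n →L[ℝ] Esp n) :
    f.det = (Matrix.of fun i j => (f (EuclideanSpace.single j (1 : ℝ))) i).det := by
  rw [ContinuousLinearMap.det, ← LinearMap.det_toMatrix (EuclideanSpace.basisFun (Fin (n + 1)) ℝ).toBasis]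
  congr 1

theorem hasFDerivAt_norm_esp (n : ℕ) {y : Esp n} (hy : y ≠ 0) :
    HasFDerivAt (fun z : Esp n => ‖z‖) (‖y‖⁻¹ • innerSL ℝ y) y := by
  have h1 : HasFDerivAt (fun z : Esp n => ‖z‖ ^ 2) (2 • innerSL ℝ y) y :=
    (hasStrictFDerivAt_norm_sq y).hasFDerivAt
  have hn : 0 < ‖y‖ := norm_pos_iff.2 hy
  have h2 := h1.sqrt (by positivity)
  have e1 : (fun z : Esp n => √(‖z‖ ^ 2)) = fun z => ‖z‖ := by
    ext z; exact Real.sqrt_sq (norm_nonneg z)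
  rw [e1, Real.sqrt_sq (norm_nonneg y)] at h2
  have e2 : (1 / (2 * ‖y‖)) • (2 • innerSL ℝ y) = ‖y‖⁻¹ • innerSL ℝ y := by
    ext v
    simp
    field_simp
  rw [e2] at h2
  exact h2

namespace GoodSupp
open Matrix

variable {n : ℕ} {h : Esp n → ℝ}

theorem hess_apply (H : GoodSupp n h) {y : Esp n} (hy : y ≠ 0) (i j : Fin (n + 1)) :
    hessMatrix n h y i j = D2 n h y (EuclideanSpace.single i 1) (EuclideanSpace.single j 1) := by
  rw [hessMatrix, Matrix.of_apply, H.hessForm_eq hy]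

theorem hess_symm (H : GoodSupp n h) {y : Esp n} (hy : y ≠ 0) :
    (hessMatrix n h y)ᵀ = hessMatrix n h y := by
  ext i j
  rw [transpose_apply, H.hess_apply hy, H.hess_apply hy, H.D2_symm hy]

theorem hess_mulVec (H : GoodSupp n h) {y : Esp n} (hy : y ≠ 0) (v : Esp n) (i : Fin (n + 1)) :
    (hessMatrix n h y *ᵥ v.ofLp) i = D2 n h y (EuclideanSpace.single i 1) v := by
  conv_rhs => rw [esp_sum n v]
  simp only [map_sum, map_smul, smul_eq_mul, mulVec, dotProduct, H.hess_apply hy]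
  exact Finset.sum_congr rfl fun j _ => mul_comm _ _

theorem hess_mulVec_self (H : GoodSupp n h) {y : Esp n} (hy : y ≠ 0) :
    hessMatrix n h y *ᵥ y.ofLp = 0 := by
  ext i
  rw [H.hess_mulVec hy, H.D2_self_right hy]; rfl

theorem hess_quad (H : GoodSupp n h) {y : Esp n} (hy : y ≠ 0) (v : Esp n) :
    v.ofLp ⬝ᵥ hessMatrix n h y *ᵥ v.ofLp = D2 n h y v v := by
  have : D2 n h y v v = ∑ i, v i * D2 n h y (EuclideanSpace.single i 1) v := by
    conv_lhs => enter [1]; rw [esp_sum n v]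
    simp [map_sum, map_smul]
  rw [this, dotProduct]
  exact Finset.sum_congr rfl fun i _ => by rw [H.hess_mulVec hy]

theorem dot_eq_inner (v w : Esp n) : v.ofLp ⬝ᵥ w.ofLp = ⟪v, w⟫ := by
  rw [EuclideanSpace.inner_eq_star_dotProduct, dotProduct_comm]; simp

theorem sigma_one (x : Esp n) : sigmaElem n 1 h x = (hessMatrix n h x).trace := by
  rw [sigmaElem, trace_eq_neg_charpoly_coeff]; simp

theorem sigma_n (x : Esp n) : sigmaElem n n h x = (-1) ^ n * (hessMatrix n h x).charpoly.coeff 1 := by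
  rw [sigmaElem]; simp

theorem inner_self_of_mem {x : Esp n} (hx : x ∈ sphere (0 : Esp n) 1) : ⟪x, x⟫ = 1 := by
  rw [real_inner_self_eq_norm_sq]; simp at hx; rw [hx]; norm_num

theorem spec (H : GoodSupp n h) {x : Esp n} (hx : x ∈ sphere (0 : Esp n) 1) :
    ∃ (s : Finset (Fin (n + 1))) (l : Fin (n + 1) → ℝ), s.card = n ∧ (∀ j ∈ s, 0 < l j) ∧
      sigmaElem n 1 h x = ∑ j ∈ s, l j ∧ sigmaElem n n h x = ∏ j ∈ s, l j ∧
      (∀ t : ℝ, (t • (1 : Matrix (Fin (n + 1)) (Fin (n + 1)) ℝ) - hessMatrix n h x).det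
        = t * ∏ j ∈ s, (t - l j)) ∧
      (∀ t : ℝ, (∀ v : Esp n, ⟪v, x⟫ = 0 → t * ⟪v, v⟫ ≤ D2 n h x v v) → ∀ j ∈ s, t ≤ l j) := by
  have hx0 := ne_zero_of_mem hx
  obtain ⟨s, l, h1, h2, h3, h4, h5, h6⟩ := spectral_data n (hessMatrix n h x) x.ofLp (H.hess_symm hx0)
    (H.hess_mulVec_self hx0) (by rw [dot_eq_inner, inner_self_of_mem hx]) (by
      intro v hv hv0
      have hq := H.hess_quad hx0 (WithLp.toLp 2 v)
      have hd := dot_eq_inner (WithLp.toLp 2 v) x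
      simp only at hq hd
      rw [hq, ← H.hessForm_eq hx0]
      refine H.conv x hx _ ?_ ?_
      · rw [← hd, hv]
      · intro h0
        apply hv0
        exact congrArg WithLp.ofLp h0)
  refine ⟨s, l, h1, h2, by rw [sigma_one, h3], by rw [sigma_n, h4], h5, ?_⟩
  intro t ht
  refine h6 t fun v hv => ?_
  have hq := H.hess_quad hx0 (WithLp.toLp 2 v)
  have hd := dot_eq_inner (WithLp.toLp 2 v) x
  have hdd := dot_eq_inner (WithLp.toLp 2 v) (WithLp.toLp 2 v)
  simp only at hq hd hdd
  rw [hq, hdd]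
  exact ht _ (by rw [← hd, hv])

theorem sigma_n_pos (H : GoodSupp n h) {x : Esp n} (hx : x ∈ sphere (0 : Esp n) 1) :
    0 < sigmaElem n n h x := by
  obtain ⟨s, l, h1, h2, h3, h4, h5, h6⟩ := H.spec hx
  rw [h4]
  exact Finset.prod_pos h2

theorem sigma_one_pos (H : GoodSupp n h) (hn : 1 ≤ n) {x : Esp n}
    (hx : x ∈ sphere (0 : Esp n) 1) : 0 < sigmaElem n 1 h x := by
  obtain ⟨s, l, h1, h2, h3, h4, h5, h6⟩ := H.spec hx
  rw [h3]
  refine Finset.sum_pos h2 (Finset.card_pos.1 (by omega))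

/-- Derivative of the radial map. -/
def phi' (n : ℕ) (h : Esp n → ℝ) (y : Esp n) : Esp n →L[ℝ] Esp n :=
  ‖y‖ • ((covec n).comp (D2 n h y)) + (‖y‖⁻¹ • innerSL ℝ y).smulRight (gr n h y)

theorem hasFDerivAt_phi (H : GoodSupp n h) {y : Esp n} (hy : y ≠ 0) :
    HasFDerivAt (fun z => ‖z‖ • gr n h z) (phi' n h y) y :=
  (hasFDerivAt_norm_esp n hy).smul (H.hasFDerivAt_gr hy)

theorem det_phi' (H : GoodSupp n h) {x : Esp n} (hx : x ∈ sphere (0 : Esp n) 1) {t : ℝ} (ht : 0 < t) :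
    (phi' n h (t • x)).det = h x * sigmaElem n n h x := by
  have hx0 := ne_zero_of_mem hx
  have hx1 : ‖x‖ = 1 := by simpa using hx
  have hnorm : ‖t • x‖ = t := by rw [norm_smul, hx1, Real.norm_of_nonneg ht.le, mul_one]
  have hmat : (Matrix.of fun i j => (phi' n h (t • x) (EuclideanSpace.single j (1 : ℝ))) i) =
      hessMatrix n h x + vecMulVec (gr n h x).ofLp x.ofLp := by
    ext i j
    rw [Matrix.of_apply, Matrix.add_apply, H.hess_apply hx0, vecMulVec_apply, phi', hnorm,
      H.gr_smul ht, H.D2_smul ht hx0, H.D2_symm hx0]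
    simp [covec_apply, EuclideanSpace.inner_single_right]
    field_simp
  rw [det_clm_eq, hmat, det_add_rankOne n _ _ _ (H.hess_symm hx0) (H.hess_mulVec_self hx0)
    (by rw [dot_eq_inner, inner_self_of_mem hx]), ← sigma_n, dot_eq_inner, inner_gr, H.euler hx0]

/-- Derivative of the normal map. -/
def gmap' (n : ℕ) (h : Esp n → ℝ) (y : Esp n) : Esp n →L[ℝ] Esp n :=
  (covec n).comp (D2 n h y) - ContinuousLinearMap.id ℝ (Esp n)

theorem hasFDerivAt_gmap (H : GoodSupp n h) {y : Esp n} (hy : y ≠ 0) :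
    HasFDerivAt (fun z => gr n h z - z) (gmap' n h y) y :=
  (H.hasFDerivAt_gr hy).sub (hasFDerivAt_id y)

theorem det_gmap' (H : GoodSupp n h) {x : Esp n} (hx : x ∈ sphere (0 : Esp n) 1) {t : ℝ} (ht : 0 < t) :
    |(gmap' n h (t • x)).det| = (t⁻¹) ^ (n + 1) *
      |(t • (1 : Matrix (Fin (n + 1)) (Fin (n + 1)) ℝ) - hessMatrix n h x).det| := by
  have hx0 := ne_zero_of_mem hx
  have hmat : (Matrix.of fun i j => (gmap' n h (t • x) (EuclideanSpace.single j (1 : ℝ))) i) =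
      (-t⁻¹) • (t • (1 : Matrix (Fin (n + 1)) (Fin (n + 1)) ℝ) - hessMatrix n h x) := by
    ext i j
    rw [Matrix.of_apply, Matrix.smul_apply, Matrix.sub_apply, H.hess_apply hx0, Matrix.smul_apply,
      gmap', H.D2_smul ht hx0, H.D2_symm hx0]
    simp [covec_apply, Matrix.one_apply]
    field_simp
    split_ifs <;> ring
  rw [det_clm_eq, hmat, det_smul, abs_mul, abs_pow, abs_neg, abs_of_pos (inv_pos.2 ht)]
  simp

/-- The contact set. -/
def contact (n : ℕ) (h : Esp n → ℝ) : Set (Esp n) :=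
  {y | y ≠ 0 ∧ ∀ v : Esp n, ⟪v, y⟫ = 0 → ⟪v, v⟫ ≤ D2 n h y v v}

/-- The pointwise determinant bound on the contact set. -/
theorem det_gmap'_le (H : GoodSupp n h) (hn : 1 ≤ n) {x : Esp n} (hx : x ∈ sphere (0 : Esp n) 1)
    {t : ℝ} (ht : 0 < t) (hy : t • x ∈ contact n h) :
    t ≤ sigmaElem n 1 h x / n ∧ t ^ n * |(gmap' n h (t • x)).det| ≤
      sigmaElem n n h x * (1 - t / (sigmaElem n 1 h x / n)) ^ n := by
  have hx0 := ne_zero_of_mem hx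
  obtain ⟨s, l, h1, h2, h3, h4, h5, h6⟩ := H.spec hx
  have hl : ∀ j ∈ s, t ≤ l j := by
    refine h6 t fun v hv => ?_
    have := hy.2 v (by rw [real_inner_smul_right, hv, mul_zero])
    rw [H.D2_smul ht hx0] at this
    simp only [_root_.smul_apply, smul_eq_mul] at this
    rw [inv_mul_eq_div, le_div_iff₀ ht] at this
    linarith
  obtain ⟨h7, h8⟩ := prod_sub_le n hn s l h1 t ht hl
  rw [H.det_gmap' hx ht, h5, h3, h4]
  refine ⟨h7, ?_⟩
  have h9 : |∏ j ∈ s, (t - l j)| = ∏ j ∈ s, (l j - t) := by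
    rw [Finset.abs_prod]
    refine Finset.prod_congr rfl fun j hj => ?_
    rw [abs_sub_comm, abs_of_nonneg (by linarith [hl j hj])]
  rw [abs_mul, abs_of_pos ht, h9]
  refine le_trans (le_of_eq ?_) h8
  rw [inv_pow, pow_succ]
  field_simp

end GoodSupp

end

section

theorem sqrt_lower (N a : ℝ) (hN : 0 ≤ N) (ha : 0 ≤ a) (h : N ^ 2 = 1 + a) :
    1 + a / 2 - a ^ 2 / 8 ≤ N := by
  by_contra! hlt
  have h1 : N ^ 2 < (1 + a / 2 - a ^ 2 / 8) ^ 2 := pow_lt_pow_left₀ hlt hN (by norm_num)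
  rw [h] at h1
  have h2 : a ^ 3 * (8 - a) < 0 := by nlinarith
  have h3 : 8 < a := by
    by_contra! h4
    have := mul_nonneg (pow_nonneg ha 3) (sub_nonneg.2 h4)
    linarith
  nlinarith

namespace GoodSupp

variable {n : ℕ} {h : Esp n → ℝ}

/-- The interior of the convex body with support function `h`. -/
def body (n : ℕ) (h : Esp n → ℝ) : Set (Esp n) := {p | ∀ z : Esp n, z ≠ 0 → ⟪p, z⟫ < h z}

theorem continuousOn (H : GoodSupp n h) : ContinuousOn h {(0 : Esp n)}ᶜ := H.sm.continuousOn

theorem sphere_subset : sphere (0 : Esp n) 1 ⊆ {(0 : Esp n)}ᶜ := fun _ hx => ne_zero_of_mem hx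

theorem sphere_nonempty : (sphere (0 : Esp n) 1).Nonempty :=
  ⟨EuclideanSpace.single 0 1, by simp⟩

theorem contact_second (H : GoodSupp n h) {p x : Esp n} (hx : x ∈ sphere (0 : Esp n) 1) {t : ℝ}
    (ht : 0 < t) (hmin : ∀ z : Esp n, z ≠ 0 → t * ‖z‖ ≤ h z - ⟪p, z⟫) (heq : h x - ⟪p, x⟫ = t)
    (hgrad : ∀ v, fderiv ℝ h x v = ⟪p, v⟫ + t * ⟪x, v⟫) {v : Esp n} (hv : ⟪v, x⟫ = 0) :
    t * ⟪v, v⟫ ≤ D2 n h x v v := by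
  have hx0 := ne_zero_of_mem hx
  have hxx := inner_self_of_mem hx
  set q := ⟪v, v⟫ with hq
  have hq0 : 0 ≤ q := real_inner_self_nonneg
  set γ : ℝ → Esp n := fun s => x + s • v with hγ
  have hγd : ∀ s, HasDerivAt γ v s := fun s => by
    have h0 := ((hasDerivAt_id s).smul_const v).const_add x
    rw [one_smul] at h0
    exact h0
  have hγ0 : ∀ s, γ s ≠ 0 := by
    intro s hs
    have : ⟪γ s, x⟫ = 0 := by rw [hs, inner_zero_left]
    rw [hγ] at this
    simp only [inner_add_left, real_inner_smul_left, hv, hxx] at this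
    norm_num at this
  have hγn : ∀ s, ‖γ s‖ ^ 2 = 1 + s ^ 2 * q := by
    intro s
    rw [← real_inner_self_eq_norm_sq, hγ]
    simp only [inner_add_left, inner_add_right, real_inner_smul_left, real_inner_smul_right, hv, hxx,
      real_inner_comm v x]
    rw [hq]
    ring
  set ψ : ℝ → ℝ := fun s => h (γ s) - ⟪p, γ s⟫ - t * (1 + (s ^ 2 * q) / 2 - (s ^ 2 * q) ^ 2 / 8)
    with hψ
  have hψ0 : ∀ s, 0 ≤ ψ s := by
    intro s
    have h1 := hmin (γ s) (hγ0 s)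
    have h2 := sqrt_lower ‖γ s‖ (s ^ 2 * q) (norm_nonneg _) (by positivity) (hγn s)
    have h3 := mul_le_mul_of_nonneg_left h2 ht.le
    simp only [hψ]
    linarith
  have hψz : ψ 0 = 0 := by
    simp only [hψ, hγ]
    simp [heq]
  have hd1 : ∀ s, HasDerivAt ψ (fderiv ℝ h (γ s) v - ⟪p, v⟫ - t * (s * q - s ^ 3 * q ^ 2 / 2)) s := by
    intro s
    have a1 : HasDerivAt (fun s => h (γ s)) (fderiv ℝ h (γ s) v) s :=
      (H.hasFDerivAt (hγ0 s)).comp_hasDerivAt s (hγd s)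
    have a2 : HasDerivAt (fun s => ⟪p, γ s⟫) ⟪p, v⟫ s :=
      ((innerSL ℝ p).hasFDerivAt (x := γ s)).comp_hasDerivAt s (hγd s)
    have a3 : HasDerivAt (fun s : ℝ => s ^ 2 * q) (2 * s * q) s := by
      simpa using (hasDerivAt_pow 2 s).mul_const q
    have a4 := (((a3.div_const 2).const_add 1).sub ((a3.pow 2).div_const 8)).const_mul t
    have a5 := (a1.sub a2).sub a4
    have e : fderiv ℝ h (γ s) v - ⟪p, v⟫ - t * (s * q - s ^ 3 * q ^ 2 / 2) =
       fderiv ℝ h (γ s) v - ⟪p, v⟫ - t * (2 * s * q / 2 - ↑2 * (s ^ 2 * q) ^ (2 - 1) * (2 * s * q) / 8) := by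
      norm_num
      left
      ring
    rw [e]
    exact a5
  have hder : deriv ψ = fun s => fderiv ℝ h (γ s) v - ⟪p, v⟫ - t * (s * q - s ^ 3 * q ^ 2 / 2) := by
    ext s; exact (hd1 s).deriv
  have hd2 : HasDerivAt (fun s => fderiv ℝ h (γ s) v - ⟪p, v⟫ - t * (s * q - s ^ 3 * q ^ 2 / 2))
      (D2 n h x v v - t * q) 0 := by
    have hγz : γ 0 = x := by simp [hγ]
    have a1 : HasDerivAt (fun s => fderiv ℝ h (γ s)) (D2 n h (γ 0) v) 0 :=
      (H.hasFDerivAt2 (hγ0 0)).comp_hasDerivAt 0 (hγd 0)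
    have a2 := a1.clm_apply (hasDerivAt_const (0 : ℝ) v)
    rw [hγz] at a2
    have a3 : HasDerivAt (fun s : ℝ => t * (s * q - s ^ 3 * q ^ 2 / 2)) (t * q) 0 := by
      have b1 := ((hasDerivAt_id (0 : ℝ)).mul_const q)
      have b2 := (((hasDerivAt_pow 3 (0 : ℝ)).mul_const (q ^ 2)).div_const 2)
      have b3 := (b1.sub b2).const_mul t
      simpa using b3
    have a4 := (a2.sub_const ⟪p, v⟫).sub a3
    simp only [map_zero, add_zero] at a4
    exact a4
  have hdd : deriv (deriv ψ) 0 = D2 n h x v v - t * q := by rw [hder]; exact hd2.deriv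
  have hdz : deriv ψ 0 = 0 := by
    rw [hder]
    simp only [hγ, zero_smul, add_zero, hgrad v, real_inner_comm v x, hv]
    first
    | (rw [real_inner_comm x v, hv]; ring)
    | ring
    | (rw [real_inner_comm v x, hv]; ring)
  by_contra! hlt
  have hneg : deriv (deriv ψ) 0 < 0 := by rw [hdd]; linarith
  have hmax := isLocalMax_of_deriv_deriv_neg hneg hdz (hd1 0).continuousAt
  have hzero : ψ =ᶠ[nhds 0] fun _ => (0 : ℝ) := by
    filter_upwards [hmax] with s hs
    rw [hψz] at hs
    exact le_antisymm hs (hψ0 s)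
  have h1 : deriv (deriv ψ) 0 = 0 := by
    rw [(hzero.deriv).deriv_eq]
    simp
  linarith

/-- Every point of the body is covered by the normal map on the contact set. -/
theorem body_subset (H : GoodSupp n h) : body n h ⊆ (fun z => gr n h z - z) '' contact n h := by
  intro p hp
  have hcont : ContinuousOn (fun x => h x - ⟪p, x⟫) (sphere (0 : Esp n) 1) :=
    (H.continuousOn.mono sphere_subset).sub (by fun_prop)
  obtain ⟨x, hx, hxmin⟩ := (isCompact_sphere (0 : Esp n) 1).exists_isMinOn sphere_nonempty hcont
  have hx0 := ne_zero_of_mem hx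
  have hx1 : ‖x‖ = 1 := by simpa using hx
  set t := h x - ⟪p, x⟫ with ht
  have htpos : 0 < t := sub_pos.2 (hp x hx0)
  have hmin : ∀ z : Esp n, z ≠ 0 → t * ‖z‖ ≤ h z - ⟪p, z⟫ := by
    intro z hz
    obtain ⟨w, hw, hzw⟩ := exists_unit hz
    have h1 : t ≤ h w - ⟪p, w⟫ := hxmin hw
    have hr : 0 < ‖z‖ := norm_pos_iff.2 hz
    have h2 : h z = ‖z‖ * h w := by conv_lhs => rw [hzw, H.hom _ hr]
    have h3 : ⟪p, z⟫ = ‖z‖ * ⟪p, w⟫ := by conv_lhs => rw [hzw, real_inner_smul_right]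
    rw [h2, h3]
    nlinarith
  have hF : HasFDerivAt (fun z => h z - ⟪p, z⟫ - t * ‖z‖)
      (fderiv ℝ h x - innerSL ℝ p - t • (‖x‖⁻¹ • innerSL ℝ x)) x :=
    ((H.hasFDerivAt hx0).sub ((innerSL ℝ p).hasFDerivAt (x := x))).sub
      ((hasFDerivAt_norm_esp n hx0).const_mul t)
  have hloc : IsLocalMin (fun z => h z - ⟪p, z⟫ - t * ‖z‖) x := by
    filter_upwards [isOpen_compl_singleton.mem_nhds hx0] with z hz
    have := hmin z hz
    rw [hx1, mul_one, ← ht]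
    linarith
  have hz := hloc.hasFDerivAt_eq_zero hF
  have hgrad : ∀ v, fderiv ℝ h x v = ⟪p, v⟫ + t * ⟪x, v⟫ := by
    intro v
    have := congrArg (fun φ : Esp n →L[ℝ] ℝ => φ v) hz
    simp [hx1] at this
    linarith
  refine ⟨t • x, ⟨smul_ne_zero htpos.ne' hx0, ?_⟩, ?_⟩
  · intro v hv
    rw [real_inner_smul_right] at hv
    have hv' : ⟪v, x⟫ = 0 := (mul_eq_zero.1 hv).resolve_left htpos.ne'
    have := H.contact_second hx htpos hmin ht.symm hgrad hv'
    rw [H.D2_smul htpos hx0]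
    simp only [smul_apply, smul_eq_mul]
    rw [inv_mul_eq_div, le_div_iff₀ htpos]
    linarith
  · simp only
    rw [H.gr_smul htpos]
    refine ext_inner_right ℝ fun v => ?_
    rw [inner_sub_left, inner_gr, hgrad, real_inner_smul_left]
    ring

theorem measurable_contact (H : GoodSupp n h) : MeasurableSet (contact n h) := by
  have hD : Continuous (fun y : ({(0 : Esp n)}ᶜ : Set (Esp n)) => D2 n h y) :=
    continuousOn_iff_continuous_domRestrict.1 H.continuousOn_D2
  have hcl : IsClosed {y : ({(0 : Esp n)}ᶜ : Set (Esp n)) | ∀ w : Esp n,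
      ‖w‖ ^ 2 * ‖(y : Esp n)‖ ^ 2 - ⟪w, (y : Esp n)⟫ ^ 2 ≤ ‖(y : Esp n)‖ ^ 2 * D2 n h y w w} := by
    have : {y : ({(0 : Esp n)}ᶜ : Set (Esp n)) | ∀ w : Esp n,
      ‖w‖ ^ 2 * ‖(y : Esp n)‖ ^ 2 - ⟪w, (y : Esp n)⟫ ^ 2 ≤ ‖(y : Esp n)‖ ^ 2 * D2 n h y w w} =
      ⋂ w : Esp n, {y : ({(0 : Esp n)}ᶜ : Set (Esp n)) |
      ‖w‖ ^ 2 * ‖(y : Esp n)‖ ^ 2 - ⟪w, (y : Esp n)⟫ ^ 2 ≤ ‖(y : Esp n)‖ ^ 2 * D2 n h y w w} := by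
      ext y; simp
    rw [this]
    refine isClosed_iInter fun w => isClosed_le (by fun_prop) ?_
    have : Continuous (fun y : ({(0 : Esp n)}ᶜ : Set (Esp n)) => D2 n h y w w) :=
      (hD.clm_apply continuous_const).clm_apply continuous_const
    fun_prop
  have himg := (MeasurableSet.subtype_image
    (isOpen_compl_singleton (x := (0 : Esp n))).measurableSet hcl.measurableSet)
  convert himg using 1
  ext y
  constructor
  · rintro ⟨hy, hc⟩
    refine ⟨⟨y, hy⟩, ?_, rfl⟩
    intro w
    have hyn : 0 < ‖y‖ ^ 2 := by have := norm_pos_iff.2 hy; positivity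
    have h1 := hc (w - (⟪w, y⟫ / ‖y‖ ^ 2) • y) (by
      rw [inner_sub_left, real_inner_smul_left, real_inner_self_eq_norm_sq]; field_simp; ring)
    simp only [map_sub, map_smul, sub_apply, smul_apply, H.D2_self hy, H.D2_self_right hy,
      inner_sub_left, inner_sub_right, real_inner_smul_left, real_inner_smul_right,
      zero_apply, smul_zero, sub_zero, real_inner_comm w y] at h1
    simp only [real_inner_self_eq_norm_sq] at h1
    have h2 := mul_le_mul_of_nonneg_left h1 hyn.le
    refine le_trans (le_of_eq ?_) h2
    simp only [real_inner_comm]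
    field_simp
    ring
  · rintro ⟨⟨y', hy⟩, hc, rfl⟩
    refine ⟨hy, fun v hv => ?_⟩
    have h1 := hc v
    simp only at h1 hv
    have hyn : 0 < ‖y'‖ ^ 2 := by have := norm_pos_iff.2 hy; positivity
    rw [hv, real_inner_self_eq_norm_sq]
      at *
    refine le_of_mul_le_mul_left ?_ hyn
    linarith
end GoodSupp

end

section

/-- Integration in polar coordinates. -/
theorem polar_lintegral (n : ℕ) (f : Esp n → ENNReal) (hf : Measurable f) :
    ∫⁻ y, f y = ∫⁻ x : sphere (0 : Esp n) 1, (∫⁻ t in Set.Ioi (0 : ℝ),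
      ENNReal.ofReal (t ^ n) * f (t • (x : Esp n))) ∂(volume : Measure (Esp n)).toSphere := by
  have hdim : Module.finrank ℝ (Esp n) - 1 = n := by simp
  have hmp := (volume : Measure (Esp n)).measurePreserving_homeomorphUnitSphereProd
  rw [hdim] at hmp
  have h1 : ∫⁻ y, f y = ∫⁻ y : ({(0 : Esp n)}ᶜ : Set (Esp n)), f y ∂(volume.comap Subtype.val) := by
    rw [lintegral_subtype_comap (measurableSet_singleton _).compl, restrict_compl_singleton]
  set g : sphere (0 : Esp n) 1 × Set.Ioi (0 : ℝ) → ENNReal :=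
    fun p => f (p.2.1 • (p.1 : Esp n)) with hg
  have hgm : Measurable g := hf.comp (by fun_prop)
  have h2 : ∫⁻ y : ({(0 : Esp n)}ᶜ : Set (Esp n)), f y ∂(volume.comap Subtype.val) =
      ∫⁻ p, g p ∂((volume : Measure (Esp n)).toSphere.prod (Measure.volumeIoiPow n)) := by
    rw [← hmp.lintegral_comp hgm]
    refine lintegral_congr fun y => ?_
    have hy : ‖(y : Esp n)‖ ≠ 0 := norm_ne_zero_iff.2 y.2
    simp only [hg, homeomorphUnitSphereProd_apply_snd_coe, homeomorphUnitSphereProd_apply_fst_coe]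
    rw [smul_smul, mul_inv_cancel₀ hy, one_smul]
  rw [h1, h2, lintegral_prod _ hgm.aemeasurable]
  refine lintegral_congr fun x => ?_
  have hm : Measurable fun t : Set.Ioi (0 : ℝ) => ENNReal.ofReal (t.1 ^ n) := by fun_prop
  rw [Measure.volumeIoiPow, lintegral_withDensity_eq_lintegral_mul _ hm
    (g := fun t => g (x, t)) (hgm.comp measurable_prodMk_left)]
  rw [← lintegral_subtype_comap measurableSet_Ioi
    (fun t => ENNReal.ofReal (t ^ n) * f (t • (x : Esp n)))]
  rfl

namespace GoodSupp

variable {n : ℕ} {h : Esp n → ℝ}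

theorem continuousOn_fderiv (H : GoodSupp n h) : ContinuousOn (fderiv ℝ h) {(0 : Esp n)}ᶜ :=
  H.contDiffOn_fderiv.continuousOn

theorem continuousOn_gr (H : GoodSupp n h) : ContinuousOn (gr n h) {(0 : Esp n)}ᶜ :=
  fun _ hy => (H.hasFDerivAt_gr hy).continuousAt.continuousWithinAt

theorem measurable_det_phi (H : GoodSupp n h) :
    Measurable (fun y => ENNReal.ofReal |(phi' n h y).det|) := by
  have h1 : ContinuousOn (phi' n h) {(0 : Esp n)}ᶜ := by
    intro y hy
    have hy' : ‖y‖ ≠ 0 := norm_ne_zero_iff.2 hy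
    refine ContinuousWithinAt.add ?_ ?_
    · exact continuous_norm.continuousWithinAt.smul
        (continuousWithinAt_const.clm_comp (H.continuousOn_D2 y hy))
    · have a1 : ContinuousWithinAt (fun y : Esp n => ‖y‖⁻¹ • innerSL ℝ y) {(0 : Esp n)}ᶜ y :=
        (continuous_norm.continuousWithinAt.inv₀ hy').smul
          (innerSL ℝ (E := Esp n)).continuous.continuousWithinAt
      have a2 := H.continuousOn_gr y hy
      have a3 := ((ContinuousLinearMap.smulRightL ℝ (Esp n) (Esp n)).continuous.continuousWithinAt.comp
        a1 (Set.mapsTo_univ _ _)).clm_apply a2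
      exact a3
  exact (measurable_of_continuousOn_compl_singleton 0
    (ContinuousLinearMap.continuous_det.comp_continuousOn h1)).abs.ennreal_ofReal

theorem measurable_det_gmap (H : GoodSupp n h) :
    Measurable (fun y => ENNReal.ofReal |(gmap' n h y).det|) := by
  have h1 : ContinuousOn (gmap' n h) {(0 : Esp n)}ᶜ := by
    intro y hy
    exact (continuousWithinAt_const.clm_comp (H.continuousOn_D2 y hy)).sub continuousWithinAt_const
  exact (measurable_of_continuousOn_compl_singleton 0
    (ContinuousLinearMap.continuous_det.comp_continuousOn h1)).abs.ennreal_ofReal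

theorem phi_injOn (H : GoodSupp n h) (hn : 1 ≤ n) (hpos : ∀ z : Esp n, z ≠ 0 → 0 < h z) :
    Set.InjOn (fun z => ‖z‖ • gr n h z) {(0 : Esp n)}ᶜ := by
  have key : ∀ y y' : Esp n, y ≠ 0 → y' ≠ 0 → ‖y‖ • gr n h y = ‖y'‖ • gr n h y' → ‖y‖ ≤ ‖y'‖ := by
    intro y y' hy hy' he
    obtain ⟨x', hx', e'⟩ := exists_unit hy'
    have h1 : ⟪‖y‖ • gr n h y, y⟫ = ⟪‖y'‖ • gr n h y', y⟫ := by rw [he]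
    rw [real_inner_smul_left, real_inner_smul_left, inner_gr, inner_gr, H.euler hy] at h1
    have h2 : fderiv ℝ h y' y ≤ h y := by
      rw [e', H.fderiv_smul (norm_pos_iff.2 hy')]
      exact H.le_supp hn (ne_zero_of_mem hx') hy
    have h3 := mul_le_mul_of_nonneg_left h2 (norm_nonneg y')
    rw [← h1] at h3
    exact le_of_mul_le_mul_right h3 (hpos y hy)
  intro y hy y' hy' he
  have hy : y ≠ 0 := hy
  have hy' : y' ≠ 0 := hy'
  have hN := le_antisymm (key y y' hy hy' he) (key y' y hy' hy he.symm)
  obtain ⟨x', hx', e'⟩ := exists_unit hy'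
  by_contra hne
  have h0 : 0 < ‖y'‖ := norm_pos_iff.2 hy'
  have h1 : ⟪‖y‖ • gr n h y, y⟫ = ⟪‖y'‖ • gr n h y', y⟫ := by
    have he : ‖y‖ • gr n h y = ‖y'‖ • gr n h y' := he
    rw [he]
  rw [real_inner_smul_left, real_inner_smul_left, inner_gr, inner_gr, H.euler hy, hN] at h1
  have h2 := mul_left_cancel₀ h0.ne' h1
  have h3 : fderiv ℝ h x' y < h y := by
    refine H.lt_of_not_pos hn (ne_zero_of_mem hx') hy ?_
    intro c hc hyc
    have hx1 : ‖x'‖ = 1 := by simpa using hx'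
    have : c = ‖y'‖ := by
      rw [← hN, hyc, norm_smul, hx1, Real.norm_of_nonneg hc.le, mul_one]
    apply hne
    rw [e', hyc, ← this]
  rw [h2, e', H.fderiv_smul h0] at h3
  exact lt_irrefl _ h3

theorem phi_image_sub (H : GoodSupp n h) (hn : 1 ≤ n) (hpos : ∀ z : Esp n, z ≠ 0 → 0 < h z) :
    (fun z => ‖z‖ • gr n h z) '' (ball (0 : Esp n) 1 \ {0}) ⊆ body n h := by
  rintro _ ⟨y, ⟨hy1, hy0⟩, rfl⟩
  have hy : y ≠ 0 := hy0
  have hy1 : ‖y‖ < 1 := by simpa using hy1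
  intro z hz
  obtain ⟨x, hx, e⟩ := exists_unit hy
  have h2 : fderiv ℝ h y z ≤ h z := by
    rw [e, H.fderiv_smul (norm_pos_iff.2 hy)]
    exact H.le_supp hn (ne_zero_of_mem hx) hz
  simp only
  rw [real_inner_smul_left, inner_gr]
  have := hpos z hz
  nlinarith [mul_le_mul_of_nonneg_left h2 (norm_nonneg y)]

theorem body_sub_phi (H : GoodSupp n h) (hpos : ∀ z : Esp n, z ≠ 0 → 0 < h z) :
    body n h \ {0} ⊆ (fun z => ‖z‖ • gr n h z) '' (ball (0 : Esp n) 1 \ {0}) := by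
  rintro p ⟨hp, hp0⟩
  have hp0 : p ≠ 0 := hp0
  have hcont : ContinuousOn (fun x => ⟪p, x⟫ / h x) (sphere (0 : Esp n) 1) :=
    ContinuousOn.div (by fun_prop) (H.continuousOn.mono sphere_subset)
      fun x hx => (hpos x (ne_zero_of_mem hx)).ne'
  obtain ⟨x, hx, hxmax⟩ := (isCompact_sphere (0 : Esp n) 1).exists_isMaxOn sphere_nonempty hcont
  have hx0 := ne_zero_of_mem hx
  have hx1 : ‖x‖ = 1 := by simpa using hx
  set r := ⟪p, x⟫ / h x with hr
  have hmax : ∀ z : Esp n, z ≠ 0 → ⟪p, z⟫ ≤ r * h z := by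
    intro z hz
    obtain ⟨w, hw, hzw⟩ := exists_unit hz
    have h1 : ⟪p, w⟫ / h w ≤ r := hxmax hw
    have hr' : 0 < ‖z‖ := norm_pos_iff.2 hz
    have h2 : h z = ‖z‖ * h w := by conv_lhs => rw [hzw, H.hom _ hr']
    have h3 : ⟪p, z⟫ = ‖z‖ * ⟪p, w⟫ := by conv_lhs => rw [hzw, real_inner_smul_right]
    rw [div_le_iff₀ (hpos w (ne_zero_of_mem hw))] at h1
    rw [h2, h3]
    nlinarith
  have heq : ⟪p, x⟫ = r * h x := by rw [hr, div_mul_cancel₀ _ (hpos x hx0).ne']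
  have hr1 : r < 1 := by
    rw [hr, div_lt_one (hpos x hx0)]
    exact hp x hx0
  have hr0 : 0 < r := by
    have h1 := hmax p hp0
    have h2 : 0 < ⟪p, p⟫ := real_inner_self_pos.2 hp0
    exact pos_of_mul_pos_left (h2.trans_le h1) (hpos p hp0).le
  have hF : HasFDerivAt (fun z => r * h z - ⟪p, z⟫) (r • fderiv ℝ h x - innerSL ℝ p) x :=
    ((H.hasFDerivAt hx0).const_mul r).sub ((innerSL ℝ p).hasFDerivAt (x := x))
  have hloc : IsLocalMin (fun z => r * h z - ⟪p, z⟫) x := by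
    filter_upwards [isOpen_compl_singleton.mem_nhds hx0] with z hz
    have := hmax z hz
    linarith
  have hz := hloc.hasFDerivAt_eq_zero hF
  have hn : ‖r • x‖ = r := by rw [norm_smul, hx1, Real.norm_of_nonneg hr0.le, mul_one]
  refine ⟨r • x, ⟨by simpa [hn] using hr1, smul_ne_zero hr0.ne' hx0⟩, ?_⟩
  simp only
  rw [hn, H.gr_smul hr0]
  refine ext_inner_right ℝ fun v => ?_
  have := congrArg (fun φ : Esp n →L[ℝ] ℝ => φ v) hz
  simp at this
  rw [real_inner_smul_left, inner_gr]
  linarith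

theorem vol_body (H : GoodSupp n h) (hn : 1 ≤ n) (hpos : ∀ z : Esp n, z ≠ 0 → 0 < h z) :
    volume (body n h) = ∫⁻ x : sphere (0 : Esp n) 1,
      ENNReal.ofReal (h x * sigmaElem n n h x / (n + 1)) ∂(volume : Measure (Esp n)).toSphere := by
  have hs : MeasurableSet (ball (0 : Esp n) 1 \ {0}) :=
    measurableSet_ball.diff (measurableSet_singleton _)
  have h1 : volume (body n h) = volume ((fun z => ‖z‖ • gr n h z) '' (ball (0 : Esp n) 1 \ {0})) := by
    refine le_antisymm ?_ (measure_mono (H.phi_image_sub hn hpos))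
    calc volume (body n h) = volume (body n h \ {0}) := (measure_sdiff_null (by simp)).symm
      _ ≤ _ := measure_mono (H.body_sub_phi hpos)
  rw [h1, ← lintegral_abs_det_fderiv_eq_addHaar_image volume hs
    (fun y hy => (H.hasFDerivAt_phi hy.2).hasFDerivWithinAt)
    ((H.phi_injOn hn hpos).mono fun y hy => hy.2), ← lintegral_indicator hs,
    polar_lintegral _ _ (H.measurable_det_phi.indicator hs)]
  refine lintegral_congr fun x => ?_
  have hx1 : ‖(x : Esp n)‖ = 1 := by simp
  have hx0 := ne_zero_of_mem x.2
  have hc : 0 ≤ h x * sigmaElem n n h x := (mul_pos (hpos x hx0) (H.sigma_n_pos x.2)).le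
  have h2 : ∀ t ∈ Set.Ioi (0 : ℝ), ENNReal.ofReal (t ^ n) *
      (ball (0 : Esp n) 1 \ {0}).indicator (fun y => ENNReal.ofReal |(phi' n h y).det|)
        (t • (x : Esp n)) = (Set.Ioo (0 : ℝ) 1).indicator
          (fun t => ENNReal.ofReal (t ^ n * (h x * sigmaElem n n h x))) t := by
    intro t ht
    have ht : 0 < t := ht
    have hnt : ‖t • (x : Esp n)‖ = t := by rw [norm_smul, hx1, Real.norm_of_nonneg ht.le, mul_one]
    by_cases h1 : t < 1
    · have m1 : t ∈ Set.Ioo (0 : ℝ) 1 := ⟨ht, h1⟩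
      have m2 : t • (x : Esp n) ∈ ball (0 : Esp n) 1 \ {0} :=
        ⟨by rw [mem_ball_zero_iff, hnt]; exact h1, smul_ne_zero ht.ne' hx0⟩
      rw [Set.indicator_of_mem m1, Set.indicator_of_mem m2, H.det_phi' x.2 ht, abs_of_nonneg hc,
        ENNReal.ofReal_mul (pow_nonneg ht.le n)]
    · rw [Set.indicator_of_notMem, Set.indicator_of_notMem, mul_zero]
      · exact fun h => h1 h.2
      · intro hh
        have := hh.1
        rw [mem_ball_zero_iff, hnt] at this
        exact h1 this
  rw [setLIntegral_congr_fun measurableSet_Ioi h2, lintegral_indicator measurableSet_Ioo,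
    Measure.restrict_restrict measurableSet_Ioo,
    Set.inter_eq_left.2 Set.Ioo_subset_Ioi_self, restrict_Ioo_eq_restrict_Ioc,
    ← ofReal_integral_eq_lintegral_ofReal]
  · rw [← intervalIntegral.integral_of_le zero_le_one, intervalIntegral.integral_mul_const,
      integral_pow]
    congr 1
    simp
    ring
  · exact (Continuous.intervalIntegrable (by fun_prop) 0 1).1
  · filter_upwards [ae_restrict_mem measurableSet_Ioc] with t ht
    exact mul_nonneg (pow_nonneg ht.1.le _) hc
end GoodSupp

end

section

namespace GoodSupp

variable {n : ℕ} {h : Esp n → ℝ}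

theorem continuous_hess (H : GoodSupp n h) :
    Continuous (fun x : sphere (0 : Esp n) 1 => hessMatrix n h x) := by
  have hD : ContinuousOn (D2 n h) (sphere (0 : Esp n) 1) := H.continuousOn_D2.mono sphere_subset
  have hD' : Continuous (fun x : sphere (0 : Esp n) 1 => D2 n h x) :=
    continuousOn_iff_continuous_domRestrict.1 hD
  refine continuous_matrix fun i j => ?_
  simp only [H.hess_apply (ne_zero_of_mem (Subtype.prop _))]
  exact (hD'.clm_apply continuous_const).clm_apply continuous_const

theorem continuous_supp (H : GoodSupp n h) :
    Continuous (fun x : sphere (0 : Esp n) 1 => h x) :=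
  continuousOn_iff_continuous_domRestrict.1 (H.continuousOn.mono sphere_subset)

theorem continuous_sigma_one (H : GoodSupp n h) :
    Continuous (fun x : sphere (0 : Esp n) 1 => sigmaElem n 1 h x) := by
  simp only [sigma_one]
  exact H.continuous_hess.matrix_trace

theorem continuous_sigma_n (H : GoodSupp n h) :
    Continuous (fun x : sphere (0 : Esp n) 1 => sigmaElem n n h x) := by
  have e : ∀ x : sphere (0 : Esp n) 1, sigmaElem n n h x =
      (hessMatrix n h x + Matrix.vecMulVec (x : Esp n).ofLp (x : Esp n).ofLp).det := by
    intro x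
    have hx0 := ne_zero_of_mem x.2
    have hxx : (x : Esp n).ofLp ⬝ᵥ (x : Esp n).ofLp = 1 := by
      rw [dot_eq_inner, inner_self_of_mem x.2]
    rw [det_add_rankOne n _ _ _ (H.hess_symm hx0) (H.hess_mulVec_self hx0) hxx, hxx, one_mul, sigma_n]
  simp only [e]
  refine (H.continuous_hess.add ?_).matrix_det
  exact Continuous.matrix_vecMulVec (by fun_prop) (by fun_prop)

/-- The Heintze–Karcher type upper bound for the volume. -/
theorem vol_le (H : GoodSupp n h) (hn : 1 ≤ n) :
    volume (body n h) ≤ ∫⁻ x : sphere (0 : Esp n) 1,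
      ENNReal.ofReal (sigmaElem n n h x * (sigmaElem n 1 h x / n) / (n + 1))
        ∂(volume : Measure (Esp n)).toSphere := by
  refine (measure_mono H.body_subset).trans ?_
  refine (addHaar_image_le_lintegral_abs_det_fderiv volume H.measurable_contact
    (fun y hy => (H.hasFDerivAt_gmap hy.1).hasFDerivWithinAt)).trans ?_
  rw [← lintegral_indicator H.measurable_contact,
    polar_lintegral _ _ (H.measurable_det_gmap.indicator H.measurable_contact)]
  refine lintegral_mono fun x => ?_
  have hx0 := ne_zero_of_mem x.2
  set s := sigmaElem n n h x with hs
  set ρ := sigmaElem n 1 h x / n with hρ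
  have hs0 : 0 < s := H.sigma_n_pos x.2
  have hρ0 : 0 < ρ := div_pos (H.sigma_one_pos hn x.2) (by exact_mod_cast hn)
  have h2 : ∀ t ∈ Set.Ioi (0 : ℝ), ENNReal.ofReal (t ^ n) *
      (contact n h).indicator (fun y => ENNReal.ofReal |(gmap' n h y).det|)
        (t • (x : Esp n)) ≤ (Set.Ioc (0 : ℝ) ρ).indicator
          (fun t => ENNReal.ofReal (s * (1 - t / ρ) ^ n)) t := by
    intro t ht
    have ht : 0 < t := ht
    by_cases hc : t • (x : Esp n) ∈ contact n h
    · obtain ⟨b1, b2⟩ := H.det_gmap'_le hn x.2 ht hc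
      have m1 : t ∈ Set.Ioc (0 : ℝ) ρ := ⟨ht, b1⟩
      rw [Set.indicator_of_mem m1, Set.indicator_of_mem hc, ← ENNReal.ofReal_mul (pow_nonneg ht.le n)]
      exact ENNReal.ofReal_le_ofReal b2
    · rw [Set.indicator_of_notMem hc, mul_zero]
      exact zero_le
  refine (setLIntegral_mono' measurableSet_Ioi h2).trans (le_of_eq ?_)
  rw [lintegral_indicator measurableSet_Ioc,
    Measure.restrict_restrict measurableSet_Ioc,
    Set.inter_eq_left.2 Set.Ioc_subset_Ioi_self,
    ← ofReal_integral_eq_lintegral_ofReal]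
  · rw [← intervalIntegral.integral_of_le hρ0.le, intervalIntegral.integral_const_mul,
      intervalIntegral.integral_comp_sub_div (fun u => u ^ n) hρ0.ne' 1, integral_pow]
    congr 1
    rw [div_self hρ0.ne']
    simp
    ring
  · exact (Continuous.intervalIntegrable (by fun_prop) 0 ρ).1
  · filter_upwards [ae_restrict_mem measurableSet_Ioc] with t ht
    have : t / ρ ≤ 1 := (div_le_one hρ0).2 ht.2
    exact mul_nonneg hs0.le (pow_nonneg (by linarith) _)

theorem body_nonempty (H : GoodSupp n h) (hn : 1 ≤ n) : (body n h).Nonempty := by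
  obtain ⟨e, he⟩ := sphere_nonempty (n := n)
  have he0 := ne_zero_of_mem he
  refine ⟨(1 / 2 : ℝ) • (gr n h e + gr n h (-e)), fun z hz => ?_⟩
  rw [real_inner_smul_left, inner_add_left, inner_gr, inner_gr]
  have h1 := H.le_supp hn he0 hz
  have h2 := H.le_supp hn (neg_ne_zero.2 he0) hz
  by_cases hp : ∀ c : ℝ, 0 < c → z ≠ c • e
  · have := H.lt_of_not_pos hn he0 hz hp
    linarith
  · push Not at hp
    obtain ⟨c, hc, hzc⟩ := hp
    have := H.lt_of_not_pos hn (neg_ne_zero.2 he0) hz (by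
      intro d hd hzd
      rw [hzc] at hzd
      have : (c + d) • e = 0 := by rw [add_smul, hzd]; simp
      rcases smul_eq_zero.1 this with h0 | h0
      · linarith
      · exact he0 h0)
    linarith

theorem hessForm_sub (H : GoodSupp n h) (a : Esp n) {y : Esp n} (hy : y ≠ 0) (v w : Esp n) :
    hessForm n (fun z => h z - ⟪a, z⟫) y v w = hessForm n h y v w := by
  have e : (fun z => fderiv ℝ (fun z => h z - ⟪a, z⟫) z w) =ᶠ[nhds y]
      fun z => fderiv ℝ h z w - ⟪a, w⟫ := by
    filter_upwards [isOpen_compl_singleton.mem_nhds hy] with z hz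
    have := (H.hasFDerivAt hz).sub ((innerSL ℝ a).hasFDerivAt (x := z))
    have e2 : fderiv ℝ (fun z => h z - ⟪a, z⟫) z = fderiv ℝ h z - innerSL ℝ a := this.fderiv
    rw [e2]
    simp
  rw [hessForm, hessForm, e.fderiv_eq, fderiv_sub_const]

theorem sigma_sub (H : GoodSupp n h) (a : Esp n) {y : Esp n} (hy : y ≠ 0) (k : ℕ) :
    sigmaElem n k (fun z => h z - ⟪a, z⟫) y = sigmaElem n k h y := by
  have : hessMatrix n (fun z => h z - ⟪a, z⟫) y = hessMatrix n h y := by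
    ext i j
    simp only [hessMatrix, Matrix.of_apply, H.hessForm_sub a hy]
  rw [sigmaElem, sigmaElem, this]

theorem sub_inner (H : GoodSupp n h) (a : Esp n) : GoodSupp n (fun z => h z - ⟪a, z⟫) where
  sm := H.sm.sub (innerSL ℝ a).contDiff.contDiffOn
  hom := by
    intro r hr x
    simp only
    rw [H.hom r hr, real_inner_smul_right]
    ring
  conv := by
    intro x hx v hv hv0
    rw [H.hessForm_sub a (ne_zero_of_mem hx)]
    exact H.conv x hx v hv hv0

theorem body_sub (a : Esp n) :
    body n (fun z => h z - ⟪a, z⟫) = (fun p => p + a) ⁻¹' body n h := by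
  ext p
  constructor
  · intro hp z hz
    have := hp z hz
    rw [inner_add_left]
    linarith
  · intro hp z hz
    have := hp z hz
    rw [inner_add_left] at this
    linarith

theorem vol_body' (H : GoodSupp n h) (hn : 1 ≤ n) {a : Esp n} (ha : a ∈ body n h) :
    volume (body n h) = ENNReal.ofReal (∫ x : sphere (0 : Esp n) 1,
      (h x - ⟪a, (x : Esp n)⟫) * sigmaElem n n h x / (n + 1)
        ∂(volume : Measure (Esp n)).toSphere) := by
  have hpos : ∀ z : Esp n, z ≠ 0 → 0 < (fun z => h z - ⟪a, z⟫) z := fun z hz => sub_pos.2 (ha z hz)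
  have h1 := (H.sub_inner a).vol_body hn hpos
  rw [body_sub, measure_preimage_add_right] at h1
  rw [h1, ofReal_integral_eq_lintegral_ofReal]
  · refine lintegral_congr fun x => ?_
    rw [H.sigma_sub a (ne_zero_of_mem x.2)]
  · refine Continuous.integrable_of_hasCompactSupport ?_ (HasCompactSupport.of_compactSpace _)
    exact ((H.continuous_supp.sub (by fun_prop)).mul H.continuous_sigma_n).div_const _
  · refine Filter.Eventually.of_forall fun x => ?_
    have b1 := hpos x (ne_zero_of_mem x.2)
    have b2 := H.sigma_n_pos x.2
    simp only [Pi.zero_apply]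
    simp only at b1
    positivity

theorem exists_scale (H : GoodSupp n h) {a : Esp n} (ha : a ∈ body n h) :
    ∃ c : ℝ, 1 < c ∧ c • a ∈ body n h := by
  have hcont : ContinuousOn (fun x => h x - ⟪a, x⟫) (sphere (0 : Esp n) 1) :=
    (H.continuousOn.mono sphere_subset).sub (by fun_prop)
  obtain ⟨x, hx, hxmin⟩ := (isCompact_sphere (0 : Esp n) 1).exists_isMinOn sphere_nonempty hcont
  set t := h x - ⟪a, x⟫ with ht
  have htpos : 0 < t := sub_pos.2 (ha x (ne_zero_of_mem hx))
  set ε := t / (2 * (‖a‖ + 1)) with hε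
  have hε0 : 0 < ε := by positivity
  have hεa : ε * ‖a‖ < t := by
    rw [hε, div_mul_eq_mul_div, div_lt_iff₀ (by positivity)]
    nlinarith [norm_nonneg a]
  refine ⟨1 + ε, by linarith, fun z hz => ?_⟩
  obtain ⟨w, hw, hzw⟩ := exists_unit hz
  have h1 : t ≤ h w - ⟪a, w⟫ := hxmin hw
  have hw1 : ‖w‖ = 1 := by simpa using hw
  have hr' : 0 < ‖z‖ := norm_pos_iff.2 hz
  have h2 : h z = ‖z‖ * h w := by conv_lhs => rw [hzw, H.hom _ hr']
  have h3 : ⟪a, z⟫ = ‖z‖ * ⟪a, w⟫ := by conv_lhs => rw [hzw, real_inner_smul_right]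
  have h4 : ⟪a, w⟫ ≤ ‖a‖ := by simpa [hw1] using real_inner_le_norm a w
  rw [real_inner_smul_left, h2, h3]
  have h5 : (1 + ε) * ⟪a, w⟫ < h w := by nlinarith
  nlinarith

theorem vol_eq (H : GoodSupp n h) (hn : 1 ≤ n) :
    volume (body n h) = ENNReal.ofReal (∫ x : sphere (0 : Esp n) 1,
      h x * sigmaElem n n h x / (n + 1) ∂(volume : Measure (Esp n)).toSphere) := by
  obtain ⟨a, ha⟩ := H.body_nonempty hn
  obtain ⟨c, hc, hca⟩ := H.exists_scale ha
  have c1 := H.continuous_supp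
  have c2 := H.continuous_sigma_n
  have i1 : Integrable (fun x : sphere (0 : Esp n) 1 => h x * sigmaElem n n h x / (n + 1))
      (volume : Measure (Esp n)).toSphere :=
    Continuous.integrable_of_hasCompactSupport ((c1.mul c2).div_const _) (HasCompactSupport.of_compactSpace _)
  have i2 : Integrable (fun x : sphere (0 : Esp n) 1 => ⟪a, (x : Esp n)⟫ * sigmaElem n n h x / (n + 1))
      (volume : Measure (Esp n)).toSphere :=
    Continuous.integrable_of_hasCompactSupport (by fun_prop) (HasCompactSupport.of_compactSpace _)
  set A := ∫ x : sphere (0 : Esp n) 1,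
      h x * sigmaElem n n h x / (n + 1) ∂(volume : Measure (Esp n)).toSphere with hA
  set B := ∫ x : sphere (0 : Esp n) 1,
      ⟪a, (x : Esp n)⟫ * sigmaElem n n h x / (n + 1) ∂(volume : Measure (Esp n)).toSphere with hB
  have key : ∀ d : ℝ, d • a ∈ body n h → volume (body n h) = ENNReal.ofReal (A - d * B) ∧
      0 ≤ A - d * B := by
    intro d hd
    have e : ∫ x : sphere (0 : Esp n) 1,
      (h x - ⟪d • a, (x : Esp n)⟫) * sigmaElem n n h x / (n + 1)
        ∂(volume : Measure (Esp n)).toSphere = A - d * B := by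
      rw [hA, hB, ← integral_const_mul, ← integral_sub i1 (i2.const_mul d)]
      refine integral_congr_ae (Filter.Eventually.of_forall fun x => ?_)
      simp only [real_inner_smul_left]
      ring
    refine ⟨by rw [H.vol_body' hn hd, e], ?_⟩
    rw [← e]
    refine integral_nonneg fun x => ?_
    have b1 := sub_pos.2 (hd x (ne_zero_of_mem x.2))
    have b2 := H.sigma_n_pos x.2
    simp only [Pi.zero_apply]
    positivity
  obtain ⟨k1, k2⟩ := key 1 (by rwa [one_smul])
  obtain ⟨k3, k4⟩ := key c hca
  have : A - 1 * B = A - c * B := by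
    rw [k1] at k3
    exact (ENNReal.ofReal_eq_ofReal_iff k2 k4).1 k3
  have hB0 : B = 0 := by
    have : (c - 1) * B = 0 := by linarith
    exact (mul_eq_zero.1 this).resolve_left (by linarith)
  rw [k1, hB0]
  simp

theorem main_sphere (H : GoodSupp n h) (hn : 1 ≤ n) :
    0 ≤ ∫ x : sphere (0 : Esp n) 1, (sigmaElem n 1 h x - n * h x) * sigmaElem n n h x
      ∂(volume : Measure (Esp n)).toSphere := by
  have c1 := H.continuous_supp
  have c2 := H.continuous_sigma_n
  have c3 := H.continuous_sigma_one
  have hn0 : (0 : ℝ) < n := by exact_mod_cast hn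
  have i1 : Integrable (fun x : sphere (0 : Esp n) 1 => h x * sigmaElem n n h x / (n + 1))
      (volume : Measure (Esp n)).toSphere :=
    Continuous.integrable_of_hasCompactSupport ((c1.mul c2).div_const _) (HasCompactSupport.of_compactSpace _)
  have i2 : Integrable (fun x : sphere (0 : Esp n) 1 =>
      sigmaElem n n h x * (sigmaElem n 1 h x / n) / (n + 1)) (volume : Measure (Esp n)).toSphere :=
    Continuous.integrable_of_hasCompactSupport (by fun_prop) (HasCompactSupport.of_compactSpace _)
  have hp : ∀ x : sphere (0 : Esp n) 1, 0 ≤ sigmaElem n n h x * (sigmaElem n 1 h x / n) / (n + 1) := by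
    intro x
    have b1 := H.sigma_n_pos x.2
    have b2 := H.sigma_one_pos hn x.2
    positivity
  have h1 := H.vol_le hn
  rw [H.vol_eq hn, ← ofReal_integral_eq_lintegral_ofReal i2 (Filter.Eventually.of_forall hp),
    ENNReal.ofReal_le_ofReal_iff (integral_nonneg hp)] at h1
  have e : ∫ x : sphere (0 : Esp n) 1, (sigmaElem n 1 h x - n * h x) * sigmaElem n n h x
      ∂(volume : Measure (Esp n)).toSphere = (n * (n + 1) : ℝ) *
      ((∫ x : sphere (0 : Esp n) 1, sigmaElem n n h x * (sigmaElem n 1 h x / n) / (n + 1)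
        ∂(volume : Measure (Esp n)).toSphere) - ∫ x : sphere (0 : Esp n) 1,
      h x * sigmaElem n n h x / (n + 1) ∂(volume : Measure (Esp n)).toSphere) := by
    rw [← integral_sub i2 i1, ← integral_const_mul]
    refine integral_congr_ae (Filter.Eventually.of_forall fun x => ?_)
    simp only
    field_simp
  rw [e]
  exact mul_nonneg (by positivity) (sub_nonneg.2 h1)

theorem final (H : GoodSupp n h) (hn : 1 ≤ n) (K : Esp n → ℝ)
    (hGauss : ∀ x ∈ sphere (0 : Esp n) 1, (K x)⁻¹ = sigmaElem n n h x) :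
    0 ≤ ∫ x in sphere (0 : Esp n) 1,
        (sigmaElem n 1 h x - n * h x) / K x ∂(sphMeasure n) := by
  have c1 := H.continuous_supp
  have c2 := H.continuous_sigma_n
  have c3 := H.continuous_sigma_one
  have := sph_nonneg_of_toSphere n (fun x => (sigmaElem n 1 h x - n * h x) * sigmaElem n n h x)
    ((c3.sub (continuous_const.mul c1)).mul c2) (H.main_sphere hn)
  rw [setIntegral_congr_fun isClosed_sphere.measurableSet (g := fun x =>
    (sigmaElem n 1 h x - n * h x) * sigmaElem n n h x)]
  · exact this
  · intro x hx
    simp only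
    rw [div_eq_mul_inv, hGauss x hx]

end GoodSupp

end

/-- Lemma 3.2.  For a closed, smooth, strictly convex hypersurface
`Mⁿ ⊆ ℝ^{n+1}` with support function `h` and Gauss curvature `𝒦`, one has
`∫_{𝕊ⁿ} (Δ̄h)/𝒦 dμ ≥ 0`.  Here `Δ̄h = σ₁(∇̄²h + ḡh, ḡ) - n h` (since `σ₁ = Δ̄h + nh` is the
trace of `∇̄²h + ḡh`). -/
theorem statement_9 (n : ℕ) (hn : 1 ≤ n)
    (h 𝒦 : Esp n → ℝ)
    (hsm : ContDiffOn ℝ (⊤ : ℕ∞) h {(0 : Esp n)}ᶜ)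
    (hhom : PosHom n h)
    (hconv : ∀ x ∈ sphere (0 : Esp n) 1, ∀ v : Esp n,
      ⟪v, x⟫ = 0 → v ≠ 0 → 0 < hessForm n h x v v)
    (hGauss : ∀ x ∈ sphere (0 : Esp n) 1, (𝒦 x)⁻¹ = sigmaElem n n h x) :
    0 ≤ ∫ x in sphere (0 : Esp n) 1,
        (sigmaElem n 1 h x - n * h x) / 𝒦 x ∂(sphMeasure n) := by
  exact GoodSupp.final ⟨hsm, hhom, hconv⟩ hn 𝒦 hGauss
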